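/- arXiv:1212.6949 — 4 statements merged into one kernel-verified Lean document; each statement's English description precedes it below -/
import Mathlib

section
/- Fix t > 0, T > 0 and x ∈ ℝ. For N ≥ 2 set c₁(N) = ((N−1)!/(2π)^N) |S_{N−1}| |S_{N−2}| T/(Nt²) and I_N(x) = ∫₀¹ dz (1−z²)^{−5/2} exp(−x²/((T/N) + t(1−z²))) (1 + T/(Nt(1−z²)))^{−N/2−1} (z² − 2Nx²(1−z²)/((N−1)T)). Then lim_{N→∞} c₁(N) · I_N(x) = (T/(2√π t²)) e^{−(x²/t + T/(2t))} ( (1/2)(x²/t + T/(2t))^{−3/2} − (2x²/T)(x²/t + T/(2t))^{−1/2} ). (This is the scaling limit of the modified two-point density ρ̃^{(N)}_{t,t+T/N}(0,x) as N → ∞.) -/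
open MeasureTheory Nat intervalIntegral

/-- `sphereArea n = |S_n| = 2π^{(n+1)/2}/Γ((n+1)/2)`, the surface area of the unit sphere
`S^n ⊂ ℝ^{n+1}`. -/
noncomputable def sphereArea (n : ℕ) : ℝ :=
  2 * Real.pi ^ (((n : ℝ) + 1) / 2) / Real.Gamma (((n : ℝ) + 1) / 2)

lemma const_eq (m : ℕ) : (((m + 1)! : ℝ) / (2 * Real.pi) ^ (m+2)) * sphereArea (m + 1) * sphereArea m
    = (m + 1) / Real.pi := by
  have h := Real.Gamma_mul_Gamma_add_half (((m : ℝ) + 1) / 2)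
  have e1 : 2 * (((m : ℝ) + 1) / 2) = m + 1 := by ring
  rw [e1, Real.Gamma_nat_eq_factorial] at h
  have hp := Real.pi_pos
  have e2 : ((m : ℝ) + 1) / 2 + 1 / 2 = (((m + 1 : ℕ) : ℝ) + 1) / 2 := by push_cast; ring
  rw [e2] at h
  have e3 : Real.pi ^ ((((m + 1 : ℕ) : ℝ) + 1) / 2) * Real.pi ^ (((m : ℝ) + 1) / 2)
      = Real.pi ^ (m + 1) * Real.sqrt Real.pi := by
    rw [Real.sqrt_eq_rpow, ← Real.rpow_natCast, ← Real.rpow_add hp, ← Real.rpow_add hp]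
    congr 1; push_cast; ring
  have e4 : (2 : ℝ) ^ (1 - ((m : ℝ) + 1)) = ((2 : ℝ) ^ m)⁻¹ := by
    rw [← Real.rpow_natCast, ← Real.rpow_neg (by norm_num)]; congr 1; ring
  rw [e4] at h
  have hs : Real.sqrt Real.pi ≠ 0 := (Real.sqrt_pos.2 hp).ne'
  have hf : ((m ! : ℕ) : ℝ) ≠ 0 := by exact_mod_cast Nat.factorial_ne_zero m
  have : sphereArea (m + 1) * sphereArea m =
      4 * (Real.pi ^ (m + 1) * Real.sqrt Real.pi) / (m ! * ((2 : ℝ) ^ m)⁻¹ * Real.sqrt Real.pi) := by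
    rw [← h, ← e3]; unfold sphereArea; rw [_root_.div_mul_div_comm]; congr 1 <;> ring
  rw [mul_assoc, this, Nat.factorial_succ]
  push_cast
  field_simp
  rw [mul_pow]; ring

lemma gauss_lim (a c : ℝ) (ha : 0 < a) :
    ∫ z in (0 : ℝ)..1, (1 - z ^ 2) ^ (-(5 : ℝ) / 2) * Real.exp (-a / (1 - z ^ 2)) *
      (z ^ 2 - c * (1 - z ^ 2)) =
    Real.exp (-a) * (Real.sqrt Real.pi / 4 * a ^ (-(3 : ℝ) / 2)
      - c * (Real.sqrt Real.pi / 2 * a ^ (-(1 : ℝ) / 2))) := by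
  rw [intervalIntegral.integral_of_le zero_le_one, integral_Ioc_eq_integral_Ioo]
  set f : ℝ → ℝ := fun u => u / Real.sqrt (1 + u ^ 2) with hf
  have hpos : ∀ u : ℝ, 0 < 1 + u ^ 2 := fun u => by positivity
  have hsq : ∀ u, f u ^ 2 = u ^ 2 / (1 + u ^ 2) := fun u => by
    simp only [hf]; rw [div_pow, Real.sq_sqrt (hpos u).le]
  have hw : ∀ u, 1 - f u ^ 2 = (1 + u ^ 2)⁻¹ := fun u => by
    rw [hsq]; have := (hpos u).ne'; field_simp; ring
  have hfpos : ∀ u, 0 < u → 0 < f u := fun u hu => div_pos hu (Real.sqrt_pos.2 (hpos u))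
  have himg : f '' Set.Ioi 0 = Set.Ioo 0 1 := by
    ext z; constructor
    · rintro ⟨u, hu, rfl⟩
      refine ⟨hfpos u hu, ?_⟩
      have h1 := hw u
      have h2 : 0 < (1 + u ^ 2)⁻¹ := inv_pos.2 (hpos u)
      nlinarith [hfpos u hu]
    · rintro ⟨h0, h1⟩
      have hz : 0 < 1 - z ^ 2 := by nlinarith
      refine ⟨z / Real.sqrt (1 - z ^ 2), div_pos h0 (Real.sqrt_pos.2 hz), ?_⟩
      have e : 1 + (z / Real.sqrt (1 - z ^ 2)) ^ 2 = (1 - z ^ 2)⁻¹ := by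
        rw [div_pow, Real.sq_sqrt hz.le]; field_simp; ring
      simp only [hf]
      rw [e, Real.sqrt_inv]
      have := (Real.sqrt_pos.2 hz).ne'
      field_simp
  have hinj : Set.InjOn f (Set.Ioi 0) := by
    intro u hu v hv h
    have h1 := hw u
    rw [h, hw v] at h1
    have h2 := inv_injective h1
    have hu' : (0:ℝ) < u := hu
    have hv' : (0:ℝ) < v := hv
    nlinarith
  have hder : ∀ u ∈ Set.Ioi (0 : ℝ), HasDerivWithinAt f ((1 + u ^ 2) ^ (-(3 : ℝ) / 2)) (Set.Ioi 0) u := by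
    intro u _
    apply HasDerivAt.hasDerivWithinAt
    have hs := Real.sqrt_pos.2 (hpos u)
    have h1 : HasDerivAt (fun u : ℝ => 1 + u ^ 2) (2 * u) u := by
      simpa using (hasDerivAt_pow 2 u).const_add 1
    have h2 := (hasDerivAt_id u).div (h1.sqrt (hpos u).ne') hs.ne'
    have h2' : HasDerivAt f _ u := h2
    refine h2'.congr_deriv (Eq.symm ?_)
    have e : (1 + u ^ 2) ^ (-(3 : ℝ) / 2) = (Real.sqrt (1 + u ^ 2) ^ 3)⁻¹ := by
      rw [Real.sqrt_eq_rpow, ← Real.rpow_natCast _ 3, ← Real.rpow_mul (hpos u).le,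
        ← Real.rpow_neg (hpos u).le]; norm_num
    have h3 := Real.sq_sqrt (hpos u).le
    rw [e]
    simp only [id]
    field_simp
    rw [h3]; ring
  rw [← himg, integral_image_eq_integral_abs_deriv_smul measurableSet_Ioi hder hinj]
  have i1 := integrableOn_rpow_mul_exp_neg_mul_sq ha (s := 2) (by norm_num)
  have i2 := (integrable_exp_neg_mul_sq ha).integrableOn (s := Set.Ioi 0)
  have g1 : ∫ u in Set.Ioi (0:ℝ), u ^ (2 : ℝ) * Real.exp (-a * u ^ 2)
      = Real.sqrt Real.pi / 4 * a ^ (-(3 : ℝ) / 2) := by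
    have := integral_rpow_mul_exp_neg_mul_rpow (p := 2) (q := 2) (b := a) (by norm_num) (by norm_num) ha
    simp only [Real.rpow_two] at this ⊢
    rw [this]
    have e : ((2:ℝ) + 1) / 2 = 1 / 2 + 1 := by norm_num
    have e' : -((2:ℝ) + 1) / 2 = -3 / 2 := by norm_num
    rw [e', e, Real.Gamma_add_one (by norm_num), Real.Gamma_one_half_eq]; ring
  have g2 : ∫ u in Set.Ioi (0:ℝ), Real.exp (-a * u ^ 2)
      = Real.sqrt Real.pi / 2 * a ^ (-(1 : ℝ) / 2) := by
    rw [integral_gaussian_Ioi, Real.sqrt_div Real.pi_pos.le, neg_div, Real.rpow_neg ha.le, ← Real.sqrt_eq_rpow]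
    ring
  rw [← g1, ← g2, ← MeasureTheory.integral_const_mul, ← MeasureTheory.integral_sub i1 (i2.const_mul c), ← MeasureTheory.integral_const_mul]
  apply setIntegral_congr_fun measurableSet_Ioi
  intro u hu
  simp only [smul_eq_mul, hw]
  rw [abs_of_pos (Real.rpow_pos_of_pos (hpos u) _), hsq, Real.inv_rpow (hpos u).le,
    ← Real.rpow_neg (hpos u).le, div_inv_eq_mul, Real.rpow_two]
  have e1 : (1 + u ^ 2) ^ (-(3 : ℝ) / 2) * (1 + u ^ 2) ^ (-(-(5 : ℝ) / 2)) = 1 + u ^ 2 := by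
    rw [← Real.rpow_add (hpos u)]; norm_num
  have e2 : Real.exp (-a * (1 + u ^ 2)) = Real.exp (-a) * Real.exp (-a * u ^ 2) := by
    rw [← Real.exp_add]; ring_nf
  rw [e2, ← mul_assoc, ← mul_assoc, e1]
  have := (hpos u).ne'
  field_simp

lemma key_bound (b N : ℝ) (hb : 0 < b) (hN : 6 ≤ N) :
    (1 + b / N) ^ (-N / 2 - 1) ≤ (b / 6) ^ (-(3 : ℝ)) := by
  have hN0 : 0 < N := by linarith
  have h0 : 0 < b / N := by positivity
  have h1 : 1 + (N / 6) * (b / N) ≤ (1 + b / N) ^ (N / 6) :=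
    one_add_mul_self_le_rpow_one_add (by linarith) (by linarith)
  have h2 : b / 6 ≤ (1 + b / N) ^ (N / 6) := by
    have : (N / 6) * (b / N) = b / 6 := by field_simp
    linarith
  calc (1 + b / N) ^ (-N / 2 - 1) ≤ (1 + b / N) ^ (N / 6 * (-3)) :=
        Real.rpow_le_rpow_of_exponent_le (by linarith) (by linarith)
    _ = ((1 + b / N) ^ (N / 6)) ^ (-(3:ℝ)) := Real.rpow_mul (by linarith) _ _
    _ ≤ _ := Real.rpow_le_rpow_of_nonpos (by positivity) h2 (by norm_num)

lemma lim_pow (b : ℝ) (hb : 0 < b) :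
    Filter.Tendsto (fun N : ℕ => (1 + b / (N : ℝ)) ^ (-(N : ℝ) / 2 - 1)) Filter.atTop
      (nhds (Real.exp (-b / 2))) := by
  have h1 := Real.tendsto_one_add_div_pow_exp b
  have h2 : Filter.Tendsto (fun N : ℕ => 1 + b / (N : ℝ)) Filter.atTop (nhds 1) := by
    simpa using (tendsto_const_div_atTop_nhds_zero_nat b).const_add 1
  have h3 := (h1.rpow_const (p := -(1/2)) (Or.inl (Real.exp_pos b).ne')).mul
    (h2.rpow_const (p := -1) (Or.inl one_ne_zero))
  have e : Real.exp b ^ (-(1/2) : ℝ) * 1 ^ (-1 : ℝ) = Real.exp (-b / 2) := by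
    rw [← Real.exp_mul, Real.one_rpow, mul_one]; ring_nf
  rw [e] at h3
  refine h3.congr fun N => ?_
  have hp : 0 < 1 + b / (N : ℝ) := by positivity
  rw [← Real.rpow_natCast, ← Real.rpow_mul hp.le, ← Real.rpow_add hp]
  ring_nf

lemma lim_int (t T : ℝ) (ht : 0 < t) (hT : 0 < T) (x : ℝ) :
    Filter.Tendsto
      (fun N : ℕ =>
          ∫ z in (0 : ℝ)..1,
            (1 - z ^ 2) ^ (-(5 : ℝ) / 2) *
              Real.exp (-x ^ 2 / (T / (N : ℝ) + t * (1 - z ^ 2))) *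
              (1 + T / ((N : ℝ) * t * (1 - z ^ 2))) ^ (-(N : ℝ) / 2 - 1) *
              (z ^ 2 - 2 * (N : ℝ) * x ^ 2 * (1 - z ^ 2) / (((N : ℝ) - 1) * T)))
      Filter.atTop
      (nhds (∫ z in (0 : ℝ)..1, (1 - z ^ 2) ^ (-(5 : ℝ) / 2) *
        Real.exp (-(x ^ 2 / t + T / (2 * t)) / (1 - z ^ 2)) *
      (z ^ 2 - (2 * x ^ 2 / T) * (1 - z ^ 2)))) := by
  have hae : ∀ᵐ z : ℝ, z ∈ Set.uIoc (0:ℝ) 1 → z ∈ Set.Ioo (0:ℝ) 1 := by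
    have : ∀ᵐ z : ℝ, z ≠ 1 := by simp [ae_iff]
    filter_upwards [this] with z hz h
    rw [Set.uIoc_of_le zero_le_one] at h
    exact ⟨h.1, lt_of_le_of_ne h.2 hz⟩
  have hwz : ∀ z ∈ Set.Ioo (0:ℝ) 1, 0 < 1 - z ^ 2 ∧ 1 - z ^ 2 ≤ 1 := fun z hz =>
    ⟨by nlinarith [hz.1, hz.2], by nlinarith [hz.1, hz.2]⟩
  apply intervalIntegral.tendsto_integral_filter_of_dominated_convergence
    (fun _ => (T / (6 * t)) ^ (-(3:ℝ)) * (1 + 4 * x ^ 2 / T))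
  · refine Filter.Eventually.of_forall fun N => ?_
    apply Measurable.aestronglyMeasurable
    fun_prop
  · filter_upwards [Filter.eventually_ge_atTop 6] with N hN
    have hN' : (6:ℝ) ≤ N := by exact_mod_cast hN
    filter_upwards [hae] with z hz hz'
    obtain ⟨hw, hw1⟩ := hwz z (hz hz')
    obtain ⟨hz0, hz1⟩ := hz hz'
    set w := 1 - z ^ 2 with hwdef
    have hb : 0 < T / (t * w) := by positivity
    have k := key_bound _ _ hb hN'
    have e : T / (t * w) / N = T / (N * t * w) := by field_simp
    rw [e] at k
    have e5 : (T / (t * w) / 6) ^ (-(3:ℝ)) = (T / (6 * t)) ^ (-(3:ℝ)) * w ^ (3:ℝ) := by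
      rw [show T / (t * w) / 6 = (T / (6 * t)) * w⁻¹ by field_simp,
        Real.mul_rpow (by positivity) (by positivity), Real.inv_rpow hw.le, ← Real.rpow_neg hw.le]
      norm_num
    rw [e5] at k
    have hC : 0 < (T / (6 * t)) ^ (-(3:ℝ)) := by positivity
    have hA : w ^ (-(5 : ℝ) / 2) * (1 + T / (N * t * w)) ^ (-(N:ℝ) / 2 - 1) ≤ (T / (6 * t)) ^ (-(3:ℝ)) := by
      calc _ ≤ w ^ (-(5 : ℝ) / 2) * ((T / (6 * t)) ^ (-(3:ℝ)) * w ^ (3:ℝ)) := by gcongr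
        _ = (T / (6 * t)) ^ (-(3:ℝ)) * (w ^ (-(5 : ℝ) / 2) * w ^ (3:ℝ)) := by ring
        _ = (T / (6 * t)) ^ (-(3:ℝ)) * w ^ (1/2 : ℝ) := by rw [← Real.rpow_add hw]; norm_num
        _ ≤ (T / (6 * t)) ^ (-(3:ℝ)) * 1 := by
            gcongr; exact Real.rpow_le_one hw.le hw1 (by norm_num)
        _ = _ := mul_one _
    have hE : Real.exp (-x ^ 2 / (T / (N : ℝ) + t * w)) ≤ 1 := by
      rw [Real.exp_le_one_iff]
      apply div_nonpos_of_nonpos_of_nonneg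
      · nlinarith [sq_nonneg x]
      · positivity
    have hD : |z ^ 2 - 2 * (N : ℝ) * x ^ 2 * w / (((N : ℝ) - 1) * T)| ≤ 1 + 4 * x ^ 2 / T := by
      have hN1 : (0:ℝ) < N - 1 := by linarith
      have h1 : 0 ≤ 2 * (N : ℝ) * x ^ 2 * w / (((N : ℝ) - 1) * T) := by positivity
      have h2 : 2 * (N : ℝ) * x ^ 2 * w / (((N : ℝ) - 1) * T) ≤ 4 * x ^ 2 / T := by
        rw [div_le_div_iff₀ (by positivity) hT]
        have : 2 * (N:ℝ) * x ^ 2 * w ≤ 2 * (2 * (N - 1)) * x ^ 2 * 1 := by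
          gcongr; linarith
        nlinarith
      rw [abs_le]; constructor <;> nlinarith [sq_nonneg z]
    have hP : 0 < (1 + T / (N * t * w)) ^ (-(N:ℝ) / 2 - 1) := by positivity
    rw [norm_mul, norm_mul, norm_mul, Real.norm_eq_abs, Real.norm_eq_abs, Real.norm_eq_abs,
      Real.norm_eq_abs, abs_of_pos (Real.exp_pos _), abs_of_pos hP,
      abs_of_pos (Real.rpow_pos_of_pos hw _)]
    refine mul_le_mul ?_ hD (abs_nonneg _) hC.le
    refine le_trans ?_ hA
    apply mul_le_mul_of_nonneg_right _ hP.le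
    exact mul_le_of_le_one_right (by positivity) hE
  · exact intervalIntegrable_const
  · filter_upwards [hae] with z hz hz'
    obtain ⟨hw, hw1⟩ := hwz z (hz hz')
    set w := 1 - z ^ 2 with hwdef
    have h1 := lim_pow (T / (t * w)) (by positivity)
    have h1' : Filter.Tendsto (fun N : ℕ => (1 + T / ((N:ℝ) * t * w)) ^ (-(N : ℝ) / 2 - 1)) Filter.atTop
      (nhds (Real.exp (-(T / (t * w)) / 2))) := by
      refine h1.congr fun N => ?_
      rw [div_div, mul_comm (t * w), mul_assoc]
    have h2 : Filter.Tendsto (fun N : ℕ => Real.exp (-x ^ 2 / (T / (N : ℝ) + t * w))) Filter.atTop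
        (nhds (Real.exp (-x ^ 2 / (0 + t * w)))) := by
      apply (Real.continuous_exp.tendsto _).comp
      apply Filter.Tendsto.div tendsto_const_nhds
      · exact (tendsto_const_div_atTop_nhds_zero_nat T).add_const _
      · positivity
    have h3 : Filter.Tendsto (fun N : ℕ => z ^ 2 - 2 * (N : ℝ) * x ^ 2 * w / (((N : ℝ) - 1) * T))
        Filter.atTop (nhds (z ^ 2 - (2 * x ^ 2 / T) * w)) := by
      have h4 : Filter.Tendsto (fun N : ℕ => z ^ 2 - 2 * x ^ 2 / T * w * (1 - 1 / (N : ℝ))⁻¹)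
        Filter.atTop (nhds (z ^ 2 - 2 * x ^ 2 / T * w * (1 - 0)⁻¹)) :=
        (((tendsto_const_div_atTop_nhds_zero_nat 1).const_sub 1).inv₀ (by norm_num)).const_mul _
          |>.const_sub _
      simp only [sub_zero, inv_one, mul_one] at h4
      refine h4.congr' ?_
      filter_upwards [Filter.eventually_ge_atTop 2] with N hN
      have hN' : (2:ℝ) ≤ N := by exact_mod_cast hN
      have : (N:ℝ) - 1 ≠ 0 := by linarith
      have h5 : (N:ℝ) ≠ 0 := by linarith
      rw [one_sub_div h5]
      field_simp
    have h6 := ((h2.const_mul (w ^ (-(5 : ℝ) / 2))).mul h1').mul h3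
    convert h6 using 2
    rw [mul_assoc (w ^ (-(5 : ℝ) / 2)) (Real.exp _) (Real.exp _), ← Real.exp_add]
    congr 3
    field_simp
    ring

/-- The scaling limit of the modified two-point density `ρ̃^{(N)}_{t,t+T/N}(0,x)`:
`c₁(N)·I_N(x)` converges as `N → ∞` to the closed-form limit, where
`c₁(N) = ((N−1)!/(2π)^N)|S_{N−1}||S_{N−2}|T/(Nt²)`. -/
theorem scaling_limit_modified_density (t T : ℝ) (ht : 0 < t) (hT : 0 < T) (x : ℝ) :
    Filter.Tendsto
      (fun N : ℕ =>
        (((N - 1)! : ℝ) / (2 * Real.pi) ^ N) * sphereArea (N - 1) * sphereArea (N - 2) *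
            T / ((N : ℝ) * t ^ 2) *
          ∫ z in (0 : ℝ)..1,
            (1 - z ^ 2) ^ (-(5 : ℝ) / 2) *
              Real.exp (-x ^ 2 / (T / (N : ℝ) + t * (1 - z ^ 2))) *
              (1 + T / ((N : ℝ) * t * (1 - z ^ 2))) ^ (-(N : ℝ) / 2 - 1) *
              (z ^ 2 - 2 * (N : ℝ) * x ^ 2 * (1 - z ^ 2) / (((N : ℝ) - 1) * T)))
      Filter.atTop
      (nhds (T / (2 * Real.sqrt Real.pi * t ^ 2) * Real.exp (-(x ^ 2 / t + T / (2 * t))) *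
        ((1 / 2) * (x ^ 2 / t + T / (2 * t)) ^ (-(3 : ℝ) / 2) -
          (2 * x ^ 2 / T) * (x ^ 2 / t + T / (2 * t)) ^ (-(1 : ℝ) / 2)))) := by
  have h1 := lim_int t T ht hT x
  rw [gauss_lim _ _ (by positivity)] at h1
  have h2 : Filter.Tendsto (fun N : ℕ => (((N - 1)! : ℝ) / (2 * Real.pi) ^ N) * sphereArea (N - 1) *
      sphereArea (N - 2) * T / ((N : ℝ) * t ^ 2)) Filter.atTop
      (nhds (T / (Real.pi * t ^ 2) * (1 - 0))) := by
    refine (((tendsto_const_div_atTop_nhds_zero_nat 1).const_sub 1).const_mul _).congr' ?_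
    filter_upwards [Filter.eventually_ge_atTop 2] with N hN
    obtain ⟨m, rfl⟩ := Nat.exists_eq_add_of_le' hN
    have e := const_eq m
    rw [show m + 2 - 1 = m + 1 by omega, show m + 2 - 2 = m by omega, e]
    push_cast
    have := Real.pi_pos
    field_simp
    ring
  convert h2.mul h1 using 2
  have hs : Real.sqrt Real.pi ≠ 0 := (Real.sqrt_pos.2 Real.pi_pos).ne'
  have e : Real.pi = Real.sqrt Real.pi ^ 2 := (Real.sq_sqrt Real.pi_pos.le).symm
  have e2 : T / (Real.pi * t ^ 2) = T / (Real.sqrt Real.pi ^ 2 * t ^ 2) := by rw [← e]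
  rw [e2]
  generalize (x ^ 2 / t + T / (2 * t)) ^ (-(3 : ℝ) / 2) = A
  generalize (x ^ 2 / t + T / (2 * t)) ^ (-(1 : ℝ) / 2) = B
  field_simp
  ring
end

section
/- Let a > 0 and b ∈ ℝ. Then ∫₀¹ (1−z²)^{−5/2} e^{−a/(1−z²)} (z² − b(1−z²)) dz = (√π/2) e^{−a} ( (1/2) a^{−3/2} − b a^{−1/2} ). (This is the substitution identity, via 1−z² = (1+w)^{−1}, used to evaluate the limiting modified two-point density in closed form.) -/
open MeasureTheory

lemma aux_u {z : ℝ} (hz : z ∈ Set.Ioo (0:ℝ) 1) : 0 < 1 - z ^ 2 := by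
  nlinarith [hz.1, hz.2]

lemma aux_sq {z : ℝ} (hz : z ∈ Set.Ioo (0:ℝ) 1) :
    (z * (1 - z ^ 2) ^ (-(1 : ℝ) / 2)) ^ 2 = z ^ 2 / (1 - z ^ 2) := by
  have hu := aux_u hz
  have h : ((1 - z ^ 2) ^ (-(1 : ℝ) / 2)) ^ 2 = (1 - z ^ 2)⁻¹ := by
    rw [← Real.rpow_natCast, ← Real.rpow_mul hu.le, ← Real.rpow_neg_one]
    norm_num
  rw [mul_pow, h, div_eq_mul_inv]

lemma aux_image :
    (fun z : ℝ => z * (1 - z ^ 2) ^ (-(1 : ℝ) / 2)) '' Set.Ioo (0:ℝ) 1 = Set.Ioi 0 := by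
  ext t
  constructor
  · rintro ⟨z, hz, rfl⟩
    exact mul_pos hz.1 (Real.rpow_pos_of_pos (aux_u hz) _)
  · intro ht
    have ht : 0 < t := ht
    have hs : 0 < Real.sqrt (1 + t ^ 2) := Real.sqrt_pos.2 (by positivity)
    have hs2 : Real.sqrt (1 + t ^ 2) ^ 2 = 1 + t ^ 2 := Real.sq_sqrt (by positivity)
    have hz : t / Real.sqrt (1 + t ^ 2) ∈ Set.Ioo (0:ℝ) 1 := by
      refine ⟨by positivity, ?_⟩
      rw [div_lt_one hs]
      nlinarith
    refine ⟨_, hz, ?_⟩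
    have h := aux_sq hz
    have hpos := mul_pos hz.1 (Real.rpow_pos_of_pos (aux_u hz) (-(1 : ℝ) / 2))
    refine (sq_eq_sq₀ hpos.le ht.le).1 ?_
    rw [h, div_pow, hs2]
    have : (1 + t ^ 2) ≠ 0 := by positivity
    have h1 : 1 - t ^ 2 / (1 + t ^ 2) = 1 / (1 + t ^ 2) := by field_simp; ring
    rw [h1]
    field_simp

lemma aux_inj :
    Set.InjOn (fun z : ℝ => z * (1 - z ^ 2) ^ (-(1 : ℝ) / 2)) (Set.Ioo (0:ℝ) 1) := by
  intro x hx y hy h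
  have h2 := congrArg (· ^ 2) h
  simp only [aux_sq hx, aux_sq hy] at h2
  rw [div_eq_div_iff (aux_u hx).ne' (aux_u hy).ne'] at h2
  exact (sq_eq_sq₀ hx.1.le hy.1.le).1 (by linarith)

lemma aux_deriv {z : ℝ} (hz : z ∈ Set.Ioo (0:ℝ) 1) :
    HasDerivAt (fun z : ℝ => z * (1 - z ^ 2) ^ (-(1 : ℝ) / 2))
      ((1 - z ^ 2) ^ (-(3 : ℝ) / 2)) z := by
  have hu := aux_u hz
  have h1 : HasDerivAt (fun z : ℝ => 1 - z ^ 2) (-(2 * z)) z := by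
    simpa using ((hasDerivAt_id z).pow 2).const_sub 1
  have h2 := (hasDerivAt_id z).mul (h1.rpow_const (p := -(1 : ℝ) / 2) (Or.inl hu.ne'))
  refine h2.congr_deriv ?_
  have e1 : (1 - z ^ 2) ^ (-(1 : ℝ) / 2) = (1 - z ^ 2) * (1 - z ^ 2) ^ (-(3 : ℝ) / 2) := by
    rw [mul_comm, ← Real.rpow_add_one hu.ne']; norm_num
  have e2 : (-(1 : ℝ) / 2 - 1) = -(3 : ℝ) / 2 := by norm_num
  simp only [id, e2]
  rw [e1]
  ring

/-- The substitution identity (via `1−z² = (1+w)⁻¹`) used to evaluate the limiting modified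
two-point density: for `a > 0` and `b ∈ ℝ`,
`∫₀¹ (1−z²)^{−5/2} e^{−a/(1−z²)} (z² − b(1−z²)) dz = (√π/2) e^{−a} ((1/2)a^{−3/2} − b a^{−1/2})`. -/
theorem substitution_identity (a b : ℝ) (ha : 0 < a) :
    ∫ z in Set.Ioo (0 : ℝ) 1,
        (1 - z ^ 2) ^ (-(5 : ℝ) / 2) * Real.exp (-a / (1 - z ^ 2)) *
          (z ^ 2 - b * (1 - z ^ 2)) =
      Real.sqrt Real.pi / 2 * Real.exp (-a) *
        ((1 / 2) * a ^ (-(3 : ℝ) / 2) - b * a ^ (-(1 : ℝ) / 2)) := by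
  have key := integral_image_eq_integral_abs_deriv_smul (measurableSet_Ioo (a := (0:ℝ)) (b := 1))
    (fun z hz => (aux_deriv hz).hasDerivWithinAt) aux_inj
    (fun t : ℝ => Real.exp (-a) * (t ^ (2:ℝ) * Real.exp (-a * t ^ (2:ℝ))
      - b * (t ^ (0:ℝ) * Real.exp (-a * t ^ (2:ℝ)))))
  rw [aux_image] at key
  have hcongr : ∫ z in Set.Ioo (0 : ℝ) 1,
        (1 - z ^ 2) ^ (-(5 : ℝ) / 2) * Real.exp (-a / (1 - z ^ 2)) *
          (z ^ 2 - b * (1 - z ^ 2)) =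
      ∫ t in Set.Ioi (0:ℝ), Real.exp (-a) * (t ^ (2:ℝ) * Real.exp (-a * t ^ (2:ℝ))
        - b * (t ^ (0:ℝ) * Real.exp (-a * t ^ (2:ℝ)))) := by
    refine (setIntegral_congr_fun measurableSet_Ioo ?_).trans key.symm
    intro z hz
    have hu := aux_u hz
    have e1 : (1 - z ^ 2) ^ (-(3 : ℝ) / 2) = (1 - z ^ 2) * (1 - z ^ 2) ^ (-(5 : ℝ) / 2) := by
      rw [mul_comm, ← Real.rpow_add_one hu.ne']; norm_num
    have e2 : Real.exp (-a / (1 - z ^ 2))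
        = Real.exp (-a) * Real.exp (-a * (z ^ 2 / (1 - z ^ 2))) := by
      rw [← Real.exp_add]; congr 1; field_simp; ring
    simp only [smul_eq_mul, Real.rpow_two, Real.rpow_zero, aux_sq hz]
    rw [abs_of_pos (Real.rpow_pos_of_pos hu _), e1, e2]
    field_simp
  rw [hcongr]
  have i2 := integrableOn_rpow_mul_exp_neg_mul_rpow (p := 2) (s := 2) (by norm_num) (by norm_num) ha
  have i0 := integrableOn_rpow_mul_exp_neg_mul_rpow (p := 2) (s := 0) (by norm_num) (by norm_num) ha
  rw [integral_const_mul, integral_sub i2 (i0.const_mul b), integral_const_mul,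
    integral_rpow_mul_exp_neg_mul_rpow (by norm_num) (by norm_num) ha,
    integral_rpow_mul_exp_neg_mul_rpow (by norm_num) (by norm_num) ha]
  have g : Real.Gamma ((2 + 1) / 2) = Real.sqrt Real.pi / 2 := by
    rw [show ((2:ℝ) + 1) / 2 = 1 / 2 + 1 by norm_num, Real.Gamma_add_one (by norm_num),
      Real.Gamma_one_half_eq]; ring
  rw [g, show ((0:ℝ) + 1) / 2 = 1 / 2 by norm_num, Real.Gamma_one_half_eq,
    show -((2:ℝ) + 1) / 2 = -3 / 2 by norm_num, show -((0:ℝ) + 1) / 2 = -1 / 2 by norm_num]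
  ring
end

section
/- Let t > 0, T > 0 and x ≥ 0. Set r = T/(2t) and α(z) = z²/t + r. Then (4/(√π t)) ∫_x^∞ (z − x) e^{−α(z)} ( (α(z) − r) α(z)^{−1/2} − (r/2) α(z)^{−3/2} ) dz = erfc(√(x²/t + T/(2t))). (This integral identity, proved by the change of variables w = α(z) and integration by parts, gives the closed form of the limiting two-time spin–spin correlation function.) -/
open MeasureTheory

/-- The complementary error function `erfc u = (2/√π) ∫_u^∞ e^{−v²} dv`. -/
noncomputable def erfc (u : ℝ) : ℝ :=
  2 / Real.sqrt Real.pi * ∫ v in Set.Ioi u, Real.exp (-v ^ 2)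

open Filter Topology

lemma gauss_int : Integrable (fun v : ℝ => Real.exp (-v ^ 2)) := by
  simpa using integrable_exp_neg_mul_sq (b := 1) one_pos

lemma E_eq (u : ℝ) : (∫ v in Set.Ioi u, Real.exp (-v ^ 2)) =
    (∫ v in Set.Ioi (0:ℝ), Real.exp (-v ^ 2)) - ∫ v in (0:ℝ)..u, Real.exp (-v ^ 2) := by
  rw [← intervalIntegral.integral_Ioi_sub_Ioi' gauss_int.integrableOn gauss_int.integrableOn]
  ring

lemma E_deriv (u : ℝ) : HasDerivAt (fun u : ℝ => ∫ v in Set.Ioi u, Real.exp (-v ^ 2))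
    (-Real.exp (-u ^ 2)) u := by
  have hc : Continuous (fun v : ℝ => Real.exp (-v ^ 2)) := by fun_prop
  have h := (hc.integral_hasStrictDerivAt 0 u).hasDerivAt.const_sub
    (∫ v in Set.Ioi (0:ℝ), Real.exp (-v ^ 2))
  refine h.congr_of_eventuallyEq (Eventually.of_forall fun y => ?_)
  exact E_eq y

lemma E_tendsto : Tendsto (fun u : ℝ => ∫ v in Set.Ioi u, Real.exp (-v ^ 2)) atTop (𝓝 0) := by
  have h := (intervalIntegral_tendsto_integral_Ioi (0:ℝ) gauss_int.integrableOn tendsto_id).const_sub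
    (∫ v in Set.Ioi (0:ℝ), Real.exp (-v ^ 2))
  rw [sub_self] at h
  exact h.congr fun y => (E_eq y).symm

lemma rpow_half (a : ℝ) (ha : 0 < a) : a ^ (-(1 : ℝ) / 2) = 1 / Real.sqrt a := by
  rw [neg_div, Real.rpow_neg ha.le, Real.sqrt_eq_rpow, one_div (_ ^ _)]

lemma rpow_three_half (a : ℝ) (ha : 0 < a) : a ^ (-(3 : ℝ) / 2) = 1 / Real.sqrt a ^ 3 := by
  rw [neg_div, Real.rpow_neg ha.le, Real.sqrt_eq_rpow, one_div (_ ^ _), ← Real.rpow_natCast,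
    ← Real.rpow_mul ha.le]
  norm_num

lemma G_deriv (t r x z : ℝ) (ht : 0 < t) (hr : 0 < r) :
    HasDerivAt (fun z : ℝ => -((z - x) * z * Real.exp (-(z ^ 2 / t + r)) /
        (2 * Real.sqrt (z ^ 2 / t + r))) -
        t / 2 * ∫ v in Set.Ioi (Real.sqrt (z ^ 2 / t + r)), Real.exp (-v ^ 2))
      ((z - x) * Real.exp (-(z ^ 2 / t + r)) *
        ((z ^ 2 / t + r - r) * (1 / Real.sqrt (z ^ 2 / t + r)) -
          r / 2 * (1 / Real.sqrt (z ^ 2 / t + r) ^ 3))) z := by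
  have ha : 0 < z ^ 2 / t + r := by positivity
  have h0 : HasDerivAt (fun z : ℝ => z ^ 2 / t + r) (2 * z / t) z := by
    simpa using ((hasDerivAt_pow 2 z).div_const t).add_const r
  have h1 := h0.sqrt ha.ne'
  have h2 := h0.neg.exp
  have h3 := ((((hasDerivAt_id z).sub_const x).mul (hasDerivAt_id z)).mul h2).div
    (h1.const_mul 2) (by positivity)
  have h4 := ((E_deriv (Real.sqrt (z ^ 2 / t + r))).comp z h1).const_mul (t / 2)
  refine (h3.neg.sub h4).congr_deriv ?_
  have hs : 0 < Real.sqrt (z ^ 2 / t + r) := Real.sqrt_pos.2 ha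
  have hsq := Real.sq_sqrt ha.le
  simp only [id, Pi.mul_apply, Pi.neg_apply, hsq]
  generalize Real.sqrt (z ^ 2 / t + r) = s at *
  generalize Real.exp (-(z ^ 2 / t + r)) = e at *
  have hr' : r = s ^ 2 - z ^ 2 / t := by linarith
  subst hr'
  field_simp
  ring

lemma f_int (t r x : ℝ) (ht : 0 < t) (hr : 0 < r) (hx : 0 ≤ x) :
    IntegrableOn (fun z : ℝ => (z - x) * Real.exp (-(z ^ 2 / t + r)) *
        ((z ^ 2 / t + r - r) * (1 / Real.sqrt (z ^ 2 / t + r)) -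
          r / 2 * (1 / Real.sqrt (z ^ 2 / t + r) ^ 3))) (Set.Ioi x) := by
  have hb : 0 < 1 / t := by positivity
  have i3 := integrable_rpow_mul_exp_neg_mul_sq hb (s := (3:ℕ)) (by norm_num)
  have i1 := integrable_rpow_mul_exp_neg_mul_sq hb (s := (1:ℕ)) (by norm_num)
  simp only [Real.rpow_natCast] at i1 i3
  have hg := (i3.const_mul (1 / t * (1 / Real.sqrt r))).add
    (i1.const_mul (r / 2 * (1 / Real.sqrt r ^ 3)))
  refine Integrable.mono' (hg.integrableOn (s := Set.Ioi x)) ?_ ?_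
  · refine Measurable.aestronglyMeasurable ?_
    fun_prop
  · refine (ae_restrict_mem measurableSet_Ioi).mono fun z hz => ?_
    have hz : x < z := hz
    have hz0 : 0 < z := by linarith
    have hsr : 0 < Real.sqrt r := Real.sqrt_pos.2 hr
    have hle : Real.sqrt r ≤ Real.sqrt (z ^ 2 / t + r) :=
      Real.sqrt_le_sqrt (by have : 0 ≤ z ^ 2 / t := by positivity
                            linarith)
    have he : Real.exp (-(z ^ 2 / t + r)) ≤ Real.exp (-(1 / t) * z ^ 2) := by
      apply Real.exp_le_exp.2
      have : -(1 / t) * z ^ 2 = - (z ^ 2 / t) := by ring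
      linarith
    have hA : |(z ^ 2 / t + r - r) * (1 / Real.sqrt (z ^ 2 / t + r)) -
          r / 2 * (1 / Real.sqrt (z ^ 2 / t + r) ^ 3)| ≤
        z ^ 2 / t * (1 / Real.sqrt r) + r / 2 * (1 / Real.sqrt r ^ 3) := by
      refine (abs_sub _ _).trans ?_
      rw [add_sub_cancel_right, abs_of_nonneg (by positivity), abs_of_nonneg (by positivity)]
      gcongr
    rw [Real.norm_eq_abs, abs_mul, abs_mul, abs_of_pos (sub_pos.2 hz), Real.abs_exp]
    calc _ ≤ z * Real.exp (-(1 / t) * z ^ 2) *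
          (z ^ 2 / t * (1 / Real.sqrt r) + r / 2 * (1 / Real.sqrt r ^ 3)) := by
          gcongr
          linarith
      _ = _ := by
          simp only [Pi.add_apply]
          ring

lemma G_tendsto (t r x : ℝ) (ht : 0 < t) (hr : 0 < r) (hx : 0 ≤ x) :
    Tendsto (fun z : ℝ => -((z - x) * z * Real.exp (-(z ^ 2 / t + r)) /
        (2 * Real.sqrt (z ^ 2 / t + r))) -
        t / 2 * ∫ v in Set.Ioi (Real.sqrt (z ^ 2 / t + r)), Real.exp (-v ^ 2)) atTop (𝓝 0) := by
  have hs : Tendsto (fun z : ℝ => Real.sqrt (z ^ 2 / t + r)) atTop atTop :=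
    Real.tendsto_sqrt_atTop.comp (tendsto_atTop_add_const_right _ _
      ((tendsto_pow_atTop two_ne_zero).atTop_div_const ht))
  have h2 := (E_tendsto.comp hs).const_mul (t / 2)
  have hb : 0 < 1 / t := by positivity
  have h3 : Tendsto (fun z : ℝ => z ^ 2 * Real.exp (-(1 / t) * z ^ 2)) atTop (𝓝 0) := by
    have h := (rpow_mul_exp_neg_mul_sq_isLittleO_exp_neg hb (2:ℕ)).isBigO.trans_tendsto
      (Real.tendsto_exp_atBot.comp
        (tendsto_id.const_mul_atTop_of_neg (show -(1 / 2 : ℝ) < 0 by norm_num)))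
    simpa only [Real.rpow_natCast] using h
  have h4 := h3.mul_const (1 / (2 * Real.sqrt r))
  rw [zero_mul] at h4
  have h1 : Tendsto (fun z : ℝ => (z - x) * z * Real.exp (-(z ^ 2 / t + r)) /
        (2 * Real.sqrt (z ^ 2 / t + r))) atTop (𝓝 0) := by
    refine squeeze_zero' ?_ ?_ h4
    · filter_upwards [eventually_gt_atTop x] with z hz
      have : 0 < z - x := sub_pos.2 hz
      have : 0 < z := by linarith
      positivity
    · filter_upwards [eventually_gt_atTop x] with z hz
      have h5 : 0 < z - x := sub_pos.2 hz
      have hz0 : 0 < z := by linarith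
      have hsr : 0 < Real.sqrt r := Real.sqrt_pos.2 hr
      have hle : Real.sqrt r ≤ Real.sqrt (z ^ 2 / t + r) :=
        Real.sqrt_le_sqrt (by have : 0 ≤ z ^ 2 / t := by positivity
                              linarith)
      have he : Real.exp (-(z ^ 2 / t + r)) ≤ Real.exp (-(1 / t) * z ^ 2) := by
        apply Real.exp_le_exp.2
        have : -(1 / t) * z ^ 2 = - (z ^ 2 / t) := by ring
        linarith
      calc _ ≤ z * z * Real.exp (-(1 / t) * z ^ 2) / (2 * Real.sqrt r) := by
            gcongr
            linarith
        _ = _ := by ring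
  simpa using h1.neg.sub h2

/-- With `r = T/(2t)` and `α(z) = z²/t + r`, the integral identity
`(4/(√π t)) ∫_x^∞ (z−x) e^{−α(z)} ((α(z)−r)α(z)^{−1/2} − (r/2)α(z)^{−3/2}) dz
  = erfc(√(x²/t + T/(2t)))` for `x ≥ 0`. -/
theorem erfc_integral_identity (t T x : ℝ) (ht : 0 < t) (hT : 0 < T) (hx : 0 ≤ x) :
    4 / (Real.sqrt Real.pi * t) *
        ∫ z in Set.Ioi x,
          (z - x) * Real.exp (-(z ^ 2 / t + T / (2 * t))) *
            (((z ^ 2 / t + T / (2 * t)) - T / (2 * t)) *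
                (z ^ 2 / t + T / (2 * t)) ^ (-(1 : ℝ) / 2) -
              (T / (2 * t)) / 2 * (z ^ 2 / t + T / (2 * t)) ^ (-(3 : ℝ) / 2)) =
      erfc (Real.sqrt (x ^ 2 / t + T / (2 * t))) := by
  have hr : 0 < T / (2 * t) := by positivity
  generalize T / (2 * t) = r at *
  have key := integral_Ioi_of_hasDerivAt_of_tendsto' (fun z _ => G_deriv t r x z ht hr)
    (f_int t r x ht hr hx) (G_tendsto t r x ht hr hx)
  have hcong : (∫ z in Set.Ioi x,
          (z - x) * Real.exp (-(z ^ 2 / t + r)) *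
            (((z ^ 2 / t + r) - r) * (z ^ 2 / t + r) ^ (-(1 : ℝ) / 2) -
              r / 2 * (z ^ 2 / t + r) ^ (-(3 : ℝ) / 2))) =
      t / 2 * ∫ v in Set.Ioi (Real.sqrt (x ^ 2 / t + r)), Real.exp (-v ^ 2) := by
    refine Eq.trans (integral_congr_ae (Eventually.of_forall fun z => ?_)) (key.trans (by simp))
    have ha : 0 < z ^ 2 / t + r := by positivity
    simp only [rpow_half _ ha, rpow_three_half _ ha]
  rw [hcong, erfc]
  have hpi : 0 < Real.sqrt Real.pi := Real.sqrt_pos.2 Real.pi_pos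
  field_simp
  try ring
end

section
/- Let N be an even positive integer, let K ≥ 2 be even, and let x₁, …, x_K ∈ ℝ. Let X = diag(x₁,…,x_K). For complex numbers (z_{pq})_{1≤q<p≤K}, let Z be the skew-symmetric K×K complex matrix with Z_{pq} = z_{pq} for p > q, Z_{pq} = −z_{qp} for p < q, and Z_{pp} = 0, and let Z† be its conjugate transpose. Then 𝔼_N[∏_{m=1}^K det(M − x_m I)] = ∏_{1≤q<p≤K} [ ∫_{ℝ²} (dz_{pq} dz̄_{pq}/π) e^{−|z_{pq}|²} ] det( [[2^{−1/2} Z, X], [−X, 2^{−1/2} Z†]] )^{N/2}, where the 2K×2K block matrix is skew-symmetric and its determinant to the power N/2 equals the N-th power of its Pfaffian. (This is the Hubbard–Stratonovich integral representation for the expected product of K characteristic polynomials of a real Ginibre matrix.) -/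
open MeasureTheory Matrix

/-- The measurable space structure on real matrices (the product σ-algebra on entries). -/
noncomputable instance matrixMeasurableSpace (N : ℕ) :
    MeasurableSpace (Matrix (Fin N) (Fin N) ℝ) :=
  inferInstanceAs (MeasurableSpace (Fin N → Fin N → ℝ))

/-- `ginibre N s` is the Gaussian probability measure `γ^N_s` on `N×N` real matrices under
which the `N²` entries are i.i.d. centered Gaussians of variance `s/2`; `ginibre N 1` is the
real Ginibre ensemble. -/
noncomputable def ginibre (N : ℕ) (s : ℝ) : Measure (Matrix (Fin N) (Fin N) ℝ) :=
  (Measure.pi fun _ : Fin N => Measure.pi fun _ : Fin N =>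
    ProbabilityTheory.gaussianReal 0 (Real.toNNReal (s / 2)) :
      Measure (Fin N → Fin N → ℝ))

/-- Index type for the strictly-lower-triangular positions `1 ≤ q < p ≤ K`. -/
abbrev LowerPairs (K : ℕ) := {p : Fin K × Fin K // p.2 < p.1}

/-- The skew-symmetric complex matrix `Z` built from the variables `z_{pq}`, `q < p`:
`Z_{pq} = z_{pq}` for `p > q`, `Z_{pq} = −z_{qp}` for `p < q`, `Z_{pp} = 0`. -/
noncomputable def skewZ (K : ℕ) (z : LowerPairs K → ℂ) : Matrix (Fin K) (Fin K) ℂ :=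
  Matrix.of fun p q =>
    if h : q < p then z ⟨(p, q), h⟩ else if h' : p < q then -z ⟨(q, p), h'⟩ else 0


section Berezin
open ExteriorAlgebra

theorem hs_comm {V : Type} [AddCommGroup V] [Module ℂ V] (p q r s : V) :
    (ι ℂ p * ι ℂ q) * (ι ℂ r * ι ℂ s) = - ((ι ℂ p * ι ℂ r) * (ι ℂ q * ι ℂ s)) := by
  have h := eq_neg_of_add_eq_zero_left (ι_add_mul_swap (R := ℂ) q r)
  calc (ι ℂ p * ι ℂ q) * (ι ℂ r * ι ℂ s) = ι ℂ p * (ι ℂ q * ι ℂ r) * ι ℂ s := by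
        simp only [mul_assoc]
    _ = _ := by rw [h]; simp only [mul_assoc, mul_neg, neg_mul]

theorem hs_comm2 {V : Type} [AddCommGroup V] [Module ℂ V] (p q r s : V) :
    (ι ℂ p * ι ℂ q) * (ι ℂ r * ι ℂ s) = (ι ℂ r * ι ℂ s) * (ι ℂ p * ι ℂ q) := by
  have h1 := eq_neg_of_add_eq_zero_left (ι_add_mul_swap (R := ℂ) p r)
  have h2 := eq_neg_of_add_eq_zero_left (ι_add_mul_swap (R := ℂ) q s)
  rw [hs_comm, h1, h2, hs_comm r s p q]
  simp

theorem exists_berezin (R : Type) [Fintype R] [DecidableEq R] :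
    ∃ (C : Type) (_ : CommRing C) (_ : Algebra ℂ C)
      (b : (R ⊕ R → ℂ) →ₗ[ℂ] (R ⊕ R → ℂ) →ₗ[ℂ] C) (T : C →ₗ[ℂ] ℂ),
      (∀ u, b u u = 0) ∧ (∀ p q r s, b p q * b r s = - (b p r * b q s)) ∧
      (∀ (k : ℕ) (u w : Fin k → (R ⊕ R → ℂ)), k ≠ Fintype.card R →
        T (∏ i, b (u i) (w i)) = 0) ∧
      T (∏ r, b (Pi.single (Sum.inl r) 1) (Pi.single (Sum.inr r) 1)) ≠ 0 := by
  set V := (R ⊕ R → ℂ) with hV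
  let s : Set (ExteriorAlgebra ℂ V) := Set.range fun p : V × V => ι ℂ p.1 * ι ℂ p.2
  have hcomm : ∀ a ∈ s, ∀ b ∈ s, a * b = b * a := by
    rintro _ ⟨p, rfl⟩ _ ⟨q, rfl⟩
    exact hs_comm2 _ _ _ _
  have := Algebra.isMulCommutative_adjoin ℂ hcomm
  let C := Algebra.adjoin ℂ s
  let instC : CommRing C := open scoped IsMulCommutative in inferInstance
  let b : V →ₗ[ℂ] V →ₗ[ℂ] C := LinearMap.mk₂ ℂ
    (fun u v => (⟨ι ℂ u * ι ℂ v, Algebra.subset_adjoin ⟨(u, v), rfl⟩⟩ : C))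
    (fun _ _ _ => Subtype.ext (by simp [add_mul]))
    (fun _ _ _ => Subtype.ext (by simp))
    (fun _ _ _ => Subtype.ext (by simp [mul_add]))
    (fun _ _ _ => Subtype.ext (by simp))
  have hb : ∀ u v, (b u v : ExteriorAlgebra ℂ V) = ι ℂ u * ι ℂ v := fun _ _ => rfl
  let d := Fintype.card R
  let e : Fin d ≃ R := (Fintype.equivFin R).symm
  let σ : Fin (d * 2) ≃ R ⊕ R :=
    finProdFinEquiv.symm.trans ((Equiv.prodCongr e finTwoEquiv).trans
      ((Equiv.prodComm _ _).trans (Equiv.boolProdEquivSum R)))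
  let B : Module.Basis (Fin (d * 2)) ℂ V := (Pi.basisFun ℂ (R ⊕ R)).reindex σ.symm
  let f : ∀ i, V [⋀^Fin i]→ₗ[ℂ] ℂ := Pi.single (d * 2) B.det
  have key : ∀ (k : ℕ) (u w : Fin k → V),
      ((∏ i, b (u i) (w i) : C) : ExteriorAlgebra ℂ V) = ιMulti ℂ (k * 2)
        (fun j => if (finProdFinEquiv.symm j).2 = 0 then u (finProdFinEquiv.symm j).1
          else w (finProdFinEquiv.symm j).1) := by
    intro k u w
    rw [ιMulti_apply, List.ofFn_mul, List.prod_flatten, ← List.prod_ofFn]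
    rw [← Subalgebra.coe_val, map_list_prod, List.map_ofFn, List.map_ofFn]
    congr 2
    funext i
    have h0 : ∀ j : Fin 2, ∀ h, finProdFinEquiv.symm (⟨i * 2 + j, h⟩ : Fin (k * 2)) = (i, j) := by
      intro j h
      rw [Equiv.symm_apply_eq]
      ext
      simp [finProdFinEquiv]; ring
    simp only [Function.comp, h0, hb, Subalgebra.coe_val]
    simp [List.ofFn_succ]
  refine ⟨C, instC, inferInstance, b, liftAlternating f ∘ₗ C.val.toLinearMap, ?_, ?_, ?_, ?_⟩
  · intro u
    exact Subtype.ext (ι_sq_zero u)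
  · intro p q r s
    exact Subtype.ext (hs_comm p q r s)
  · intro k u w hk
    simp only [LinearMap.comp_apply, AlgHom.toLinearMap_apply, Subalgebra.coe_val, key]
    rw [liftAlternating_apply_ιMulti]
    simp only [f]
    rw [Pi.single_eq_of_ne]
    · rfl
    · show k * 2 ≠ d * 2
      simpa [d] using hk
  · rw [← e.prod_comp]
    simp only [LinearMap.comp_apply, AlgHom.toLinearMap_apply, Subalgebra.coe_val, key]
    rw [liftAlternating_apply_ιMulti]
    simp only [f, Pi.single_eq_same]
    have : (fun j : Fin (d * 2) => if (finProdFinEquiv.symm j).2 = 0 then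
        (Pi.single (Sum.inl (e (finProdFinEquiv.symm j).1)) 1 : V)
        else Pi.single (Sum.inr (e (finProdFinEquiv.symm j).1)) 1) = B := by
      funext j
      simp only [B, Module.Basis.coe_reindex, Function.comp, Equiv.symm_symm, Pi.basisFun_apply, σ,
        Equiv.trans_apply]
      obtain ⟨⟨i, j⟩, rfl⟩ := finProdFinEquiv.surjective j
      have e0 : finTwoEquiv 0 = false := rfl
      have e1 : finTwoEquiv 1 = true := rfl
      fin_cases j <;> simp [Equiv.boolProdEquivSum, e0, e1]
    rw [this, Module.Basis.det_self]
    exact one_ne_zero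

end Berezin

section Algebra
variable {C : Type} [CommRing C] [Algebra ℚ C]

theorem nexp_sum {α : Type} (s : Finset α) (y : α → C) (h : ∀ a ∈ s, IsNilpotent (y a)) :
    IsNilpotent (∑ a ∈ s, y a) ∧
    IsNilpotent.exp (∑ a ∈ s, y a) = ∏ a ∈ s, IsNilpotent.exp (y a) := by
  classical
  induction s using Finset.induction_on with
  | empty => simp [IsNilpotent.exp_zero]
  | insert a s ha ih =>
    obtain ⟨h1, h2⟩ := ih fun b hb => h b (Finset.mem_insert_of_mem hb)
    have h3 := h a (Finset.mem_insert_self _ _)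
    rw [Finset.sum_insert ha, Finset.prod_insert ha, ← h2]
    exact ⟨(Commute.all _ _).isNilpotent_add h3 h1,
      IsNilpotent.exp_add_of_commute (Commute.all _ _) h3 h1⟩

theorem berezin_det [Algebra ℂ C] {V : Type} [AddCommGroup V] [Module ℂ V] (b : V →ₗ[ℂ] V →ₗ[ℂ] C)
    (T : C →ₗ[ℂ] ℂ) (d : ℕ)
    (hb0 : ∀ u, b u u = 0) (hb : ∀ p q r s, b p q * b r s = - (b p r * b q s))
    (hT : ∀ (k : ℕ) (u w : Fin k → V), k ≠ d → T (∏ i, b (u i) (w i)) = 0)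
    {R : Type} [Fintype R] [DecidableEq R] (hR : Fintype.card R = d)
    (u w : R → V) (A : Matrix R R ℂ) :
    T (IsNilpotent.exp (∑ r, ∑ c, A r c • b (u r) (w c))) = A.det * T (∏ r, b (u r) (w r)) := by
  let L : (R → ℂ) →ₗ[ℂ] V := Fintype.linearCombination ℂ w
  have hL : ∀ r, ∑ c, A r c • b (u r) (w c) = b (u r) (L (A r)) := by
    intro r
    simp [L, Fintype.linearCombination_apply]
  have hsq : ∀ p q, b p q ^ 2 = 0 := by
    intro p q; rw [pow_two, hb, hb0]; simp
  simp only [hL]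
  rw [(nexp_sum _ _ fun r _ => ⟨2, hsq _ _⟩).2]
  have hexp : ∀ p q, IsNilpotent.exp (b p q) = 1 + b p q := by
    intro p q
    rw [IsNilpotent.exp_eq_sum (hsq p q)]
    simp [Finset.sum_range_succ]
  simp only [hexp]
  rw [Finset.prod_one_add, map_sum, Finset.sum_eq_single Finset.univ]
  · let f : (R → ℂ) [⋀^R]→ₗ[ℂ] ℂ :=
      { T.compMultilinearMap ((MultilinearMap.mkPiAlgebra ℂ R C).compLinearMap
          fun r => b (u r) ∘ₗ L) with
        map_eq_zero_of_eq' := by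
          intro v i j hij hne
          simp only [LinearMap.compMultilinearMap_apply, MultilinearMap.toFun_eq_coe,
            MultilinearMap.compLinearMap_apply, MultilinearMap.mkPiAlgebra_apply,
            LinearMap.comp_apply]
          rw [← Finset.mul_prod_erase _ _ (Finset.mem_univ i),
            ← Finset.mul_prod_erase (a := j) _ _ (by simp [hne.symm]), ← mul_assoc, hij, hb, hb0]
          simp }
    have hf : ∀ v, f v = T (∏ r, b (u r) (L (v r))) := fun v => rfl
    have h1 := f.eq_smul_basis_det (Pi.basisFun ℂ R)
    have h3 : f (fun r => A r) = f (Pi.basisFun ℂ R) * A.det := by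
      conv_lhs => rw [h1]
      rw [AlternatingMap.smul_apply, Pi.basisFun_det, smul_eq_mul]
      rfl
    rw [← hf (fun r => A r), h3, hf, mul_comm]
    congr 2
    refine Finset.prod_congr rfl fun r _ => ?_
    congr 1
    simp [L]
  · intro s _ hs
    have : s.card ≠ d := by
      rw [← hR]; intro h; exact hs (Finset.card_eq_iff_eq_univ s |>.1 h)
    have h4 := hT s.card (fun i => u (s.equivFin.symm i)) (fun i => L (A (s.equivFin.symm i))) this
    rw [s.equivFin.symm.prod_comp (fun r : s => b (u r) (L (A r)))] at h4
    rw [← h4, Finset.prod_coe_sort s (fun r => b (u r) (L (A r)))]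
  · simp
end Algebra
section Analytic
open scoped Nat

noncomputable def gmom (k : ℕ) : ℝ := if Even k then (k ! : ℝ) / (4 ^ (k / 2) * ((k / 2)! : ℝ)) else 0

theorem integrable_pow_gauss (k : ℕ) : Integrable fun t : ℝ => t ^ k * Real.exp (-t ^ 2) := by
  have := integrable_rpow_mul_exp_neg_mul_sq (b := 1) one_pos (s := (k : ℝ))
    (by have : (0:ℝ) ≤ k := by positivity
        linarith)
  simpa using this

theorem integral_pow_gauss (k : ℕ) :
    ∫ t : ℝ, t ^ k * Real.exp (-t ^ 2) = √Real.pi * gmom k := by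
  rcases Nat.even_or_odd k with hk | hk
  · obtain ⟨j, rfl⟩ := hk
    have h1 : ∀ t : ℝ, t ^ (j + j) * Real.exp (-t ^ 2) =
        (fun t : ℝ => t ^ (j + j) * Real.exp (-t ^ 2)) |t| := by
      intro t
      simp only [sq_abs]
      rw [Even.pow_abs ⟨j, rfl⟩]
    rw [integral_congr_ae (Filter.Eventually.of_forall h1), integral_comp_abs (f := fun t : ℝ => t ^ (j + j) * Real.exp (-t ^ 2))]
    have h2 := integral_rpow_mul_exp_neg_rpow (p := 2) (q := ((j + j : ℕ) : ℝ)) two_pos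
      (by have : (0:ℝ) ≤ ((j + j : ℕ) : ℝ) := by positivity
          linarith)
    have h3 : (((j + j : ℕ) : ℝ) + 1) / 2 = j + 1 / 2 := by push_cast; ring
    rw [h3, Real.Gamma_nat_add_half] at h2
    simp only [Real.rpow_natCast, Real.rpow_ofNat] at h2
    rw [h2, gmom, if_pos ⟨j, rfl⟩]
    have h4 : (j + j) / 2 = j := by omega
    rw [h4]
    have h5 : ((j + j)! : ℝ) = (2 * j - 1 : ℕ)‼ * (2 ^ j * j !) := by
      rcases j with _ | j
      · simp
      · have e1 : j + 1 + (j + 1) = (2 * j + 1) + 1 := by ring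
        have e2 : 2 * (j + 1) - 1 = 2 * j + 1 := by omega
        rw [e1, e2, Nat.factorial_eq_mul_doubleFactorial]
        have e3 : 2 * j + 1 + 1 = 2 * (j + 1) := by ring
        rw [e3, Nat.doubleFactorial_two_mul]
        push_cast; ring
    rw [h5]
    have h6 : (4 : ℝ) ^ j = 2 ^ j * 2 ^ j := by rw [← mul_pow]; norm_num
    rw [h6]
    field_simp
  · rw [gmom, if_neg (by simpa using hk), mul_zero]
    have h1 := integral_neg_eq_self (fun t : ℝ => t ^ k * Real.exp (-t ^ 2)) volume
    simp only [hk.neg_pow, neg_sq, neg_mul, integral_neg] at h1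
    linarith

theorem gaussianReal_half_moment (k : ℕ) :
    Integrable (fun t : ℝ => t ^ k) (ProbabilityTheory.gaussianReal 0 (Real.toNNReal (1 / 2))) ∧
    ∫ t, t ^ k ∂(ProbabilityTheory.gaussianReal 0 (Real.toNNReal (1 / 2))) = gmom k := by
  have hv : Real.toNNReal (1 / 2) ≠ 0 := by simp
  have hp : ∀ t, ProbabilityTheory.gaussianPDFReal 0 (Real.toNNReal (1 / 2)) t =
      (√Real.pi)⁻¹ * Real.exp (-t ^ 2) := by
    intro t
    rw [ProbabilityTheory.gaussianPDFReal]
    have : ((Real.toNNReal (1 / 2) : NNReal) : ℝ) = 1 / 2 := Real.coe_toNNReal _ (by norm_num)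
    rw [this]
    congr 2
    · congr 1; ring
    · ring
  constructor
  · have := (ProbabilityTheory.memLp_id_gaussianReal (μ := 0) (v := Real.toNNReal (1 / 2)) k).integrable_norm_pow'
    simp only [id] at this
    rw [← integrable_norm_iff (by fun_prop)]
    simpa using this
  · rw [ProbabilityTheory.integral_gaussianReal_eq_integral_smul hv]
    simp only [hp, smul_eq_mul]
    have : ∀ t : ℝ, (√Real.pi)⁻¹ * Real.exp (-t ^ 2) * t ^ k =
      (√Real.pi)⁻¹ * (t ^ k * Real.exp (-t ^ 2)) := fun t => by ring
    simp only [this, integral_const_mul, integral_pow_gauss]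
    have : √Real.pi ≠ 0 := by positivity
    field_simp

structure GaussFam {Ω : Type} [MeasurableSpace Ω] (μ : Measure Ω) {α : Type} [Fintype α]
    (w : Ω → ℝ) (g : α → Ω → ℝ) : Prop where
  int : ∀ f : α → ℕ, Integrable (fun ω => w ω * ∏ a, g a ω ^ f a) μ
  eq : ∀ f : α → ℕ, ∫ ω, w ω * ∏ a, g a ω ^ f a ∂μ = ∏ a, gmom (f a)

theorem gaussFam_pi (N : ℕ) : GaussFam (Measure.pi fun _ : Fin N => Measure.pi fun _ : Fin N =>
    ProbabilityTheory.gaussianReal 0 (Real.toNNReal (1 / 2))) (fun _ => 1)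
    (fun (a : Fin N × Fin N) (M : Fin N → Fin N → ℝ) => M a.1 a.2) := by
  have h : ∀ f : Fin N × Fin N → ℕ, (fun M : Fin N → Fin N → ℝ =>
      (1 : ℝ) * ∏ a : Fin N × Fin N, M a.1 a.2 ^ f a) =
      fun M => ∏ i, (fun r : Fin N → ℝ => ∏ j, (fun t : ℝ => t ^ f (i, j)) (r j)) (M i) := by
    intro f; funext M
    rw [one_mul, Fintype.prod_prod_type]
  constructor
  · intro f
    rw [h]
    refine Integrable.fintype_prod (f := fun i (r : Fin N → ℝ) => ∏ j, r j ^ f (i, j)) fun i => ?_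
    exact Integrable.fintype_prod (f := fun j (t : ℝ) => t ^ f (i, j))
      fun j => (gaussianReal_half_moment _).1
  · intro f
    rw [h, integral_fintype_prod_eq_prod (fun i (r : Fin N → ℝ) => ∏ j, r j ^ f (i, j)),
      Fintype.prod_prod_type]
    refine Finset.prod_congr rfl fun i _ => ?_
    rw [integral_fintype_prod_eq_prod (fun j (t : ℝ) => t ^ f (i, j))]
    exact Finset.prod_congr rfl fun j _ => (gaussianReal_half_moment _).2

theorem complex_moment (j k : ℕ) :
    Integrable (fun z : ℂ => Real.pi⁻¹ * Real.exp (-‖z‖ ^ 2) * (z.re ^ j * z.im ^ k)) ∧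
    ∫ z : ℂ, Real.pi⁻¹ * Real.exp (-‖z‖ ^ 2) * (z.re ^ j * z.im ^ k) = gmom j * gmom k := by
  have h : (fun z : ℂ => Real.pi⁻¹ * Real.exp (-‖z‖ ^ 2) * (z.re ^ j * z.im ^ k)) =
      (fun p : ℝ × ℝ => (Real.pi⁻¹ * (p.1 ^ j * Real.exp (-p.1 ^ 2))) *
        (p.2 ^ k * Real.exp (-p.2 ^ 2))) ∘ Complex.measurableEquivRealProd := by
    funext z
    simp only [Function.comp, Complex.measurableEquivRealProd_apply]
    rw [← Complex.normSq_eq_norm_sq, Complex.normSq_apply, show -(z.re * z.re + z.im * z.im) =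
      -z.re ^ 2 + -z.im ^ 2 by ring, Real.exp_add]
    ring
  constructor
  · rw [h, Complex.volume_preserving_equiv_real_prod.integrable_comp_emb
      (MeasurableEquiv.measurableEmbedding _)]
    exact ((integrable_pow_gauss j).const_mul _).mul_prod (integrable_pow_gauss k)
  · rw [h]
    unfold Function.comp
    rw [Complex.volume_preserving_equiv_real_prod.integral_comp'
      (g := (fun p : ℝ × ℝ => (Real.pi⁻¹ * (p.1 ^ j * Real.exp (-p.1 ^ 2))) *
        (p.2 ^ k * Real.exp (-p.2 ^ 2)))), Measure.volume_eq_prod, integral_prod_mul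
        (fun t : ℝ => Real.pi⁻¹ * (t ^ j * Real.exp (-t ^ 2)))
        (fun t : ℝ => t ^ k * Real.exp (-t ^ 2)),
      integral_const_mul, integral_pow_gauss, integral_pow_gauss]
    have h1 : √Real.pi * √Real.pi = Real.pi := Real.mul_self_sqrt Real.pi_pos.le
    have h2 := Real.pi_ne_zero
    calc _ = Real.pi⁻¹ * (√Real.pi * √Real.pi) * (gmom j * gmom k) := by ring
      _ = _ := by rw [h1]; field_simp

theorem gaussFam_complex (P : Type) [Fintype P] :
    GaussFam (Measure.pi fun _ : P => (volume : Measure ℂ))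
    (fun z => ∏ p : P, (Real.pi⁻¹ * Real.exp (-‖z p‖ ^ 2)))
    (fun (a : P ⊕ P) (z : P → ℂ) => Sum.elim (fun p => (z p).re) (fun p => (z p).im) a) := by
  have h : ∀ f : P ⊕ P → ℕ, (fun z : P → ℂ =>
      (∏ p : P, (Real.pi⁻¹ * Real.exp (-‖z p‖ ^ 2))) * ∏ a : P ⊕ P,
        Sum.elim (fun p => (z p).re) (fun p => (z p).im) a ^ f a) =
      fun z => ∏ p, (fun p (z : ℂ) => Real.pi⁻¹ * Real.exp (-‖z‖ ^ 2) *
        (z.re ^ f (Sum.inl p) * z.im ^ f (Sum.inr p))) p (z p) := by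
    intro f; funext z
    rw [Fintype.prod_sum_type, ← Finset.prod_mul_distrib, ← Finset.prod_mul_distrib]
    simp
  constructor
  · intro f
    rw [h]
    exact Integrable.fintype_prod fun p => (complex_moment _ _).1
  · intro f
    rw [h, integral_fintype_prod_eq_prod (fun p (z : ℂ) => Real.pi⁻¹ * Real.exp (-‖z‖ ^ 2) *
        (z.re ^ f (Sum.inl p) * z.im ^ f (Sum.inr p)))]
    rw [Fintype.prod_sum_type, ← Finset.prod_mul_distrib]
    exact Finset.prod_congr rfl fun p _ => (complex_moment _ _).2

theorem sum_range_two_mul' {M : Type} [AddCommMonoid M] (F : ℕ → M) (h : ∀ k, ¬ Even k → F k = 0)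
    (L : ℕ) : ∑ k ∈ Finset.range (2 * L), F k = ∑ k ∈ Finset.range L, F (2 * k) := by
  induction L with
  | zero => simp
  | succ n ih =>
    rw [show 2 * (n + 1) = 2 * n + 1 + 1 by ring, Finset.sum_range_succ, Finset.sum_range_succ, ih,
      h (2 * n + 1) (by simp), add_zero, Finset.sum_range_succ]

section Wick
variable {C : Type} [CommRing C] [Algebra ℚ C] [Algebra ℂ C]

theorem nexp_eq {a : C} {k : ℕ} (h : a ^ k = 0) :
    IsNilpotent.exp a = ∑ i ∈ Finset.range k, ((i ! : ℂ)⁻¹) • a ^ i := by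
  rw [IsNilpotent.exp_eq_sum h]
  refine Finset.sum_congr rfl fun i _ => ?_
  rw [← Rat.cast_smul_eq_qsmul ℂ]
  push_cast
  rfl

theorem wick {Ω : Type} [MeasurableSpace Ω] (μ : Measure Ω) {α : Type} [Fintype α]
    (w : Ω → ℝ) (g : α → Ω → ℝ) (hg : GaussFam μ w g) (T : C →ₗ[ℂ] ℂ) (Q0 : C) (Q : α → C)
    (h0 : IsNilpotent Q0) (hQ : ∀ a, IsNilpotent (Q a)) :
    ∫ ω, (w ω : ℂ) * T (IsNilpotent.exp (Q0 + ∑ a, (g a ω : ℂ) • Q a)) ∂μ =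
      T (IsNilpotent.exp (Q0 + (1 / 4 : ℂ) • ∑ a, Q a ^ 2)) := by
  classical
  choose n hn using hQ
  let L := ∑ a, n a
  have hL : ∀ a, Q a ^ L = 0 := fun a =>
    pow_eq_zero_of_le (Finset.single_le_sum (f := n) (fun _ _ => Nat.zero_le _) (Finset.mem_univ a))
      (hn a)
  have hL1 : ∀ a (t : ℂ), (t • Q a) ^ (2 * L) = 0 := fun a t => by
    rw [smul_pow, pow_eq_zero_of_le (by omega) (hL a), smul_zero]
  have hL2 : ∀ a, ((1 / 4 : ℂ) • Q a ^ 2) ^ L = 0 := fun a => by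
    rw [smul_pow, ← pow_mul, pow_eq_zero_of_le (by omega) (hL a), smul_zero]
  have hadd : ∀ y : α → C, (∀ a, IsNilpotent (y a)) → IsNilpotent.exp (Q0 + ∑ a, y a) =
      IsNilpotent.exp Q0 * ∏ a, IsNilpotent.exp (y a) := by
    intro y hy
    have := nexp_sum Finset.univ y (fun a _ => hy a)
    rw [IsNilpotent.exp_add_of_commute (Commute.all _ _) h0 this.1, this.2]
  have e1 : ∀ ω, T (IsNilpotent.exp (Q0 + ∑ a, (g a ω : ℂ) • Q a)) =
      ∑ p ∈ Fintype.piFinset (fun _ : α => Finset.range (2 * L)),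
        ((∏ a, g a ω ^ p a : ℝ) : ℂ) *
        ((∏ a, ((p a)! : ℂ)⁻¹) * T (IsNilpotent.exp Q0 * ∏ a, Q a ^ p a)) := by
    intro ω
    rw [hadd _ fun a => ⟨_, hL1 a _⟩]
    simp only [nexp_eq (hL1 _ _)]
    rw [Finset.prod_univ_sum, Finset.mul_sum, map_sum]
    refine Finset.sum_congr rfl fun p _ => ?_
    simp only [smul_pow, smul_smul]
    rw [Finset.prod_smul, mul_smul_comm, map_smul, Finset.prod_mul_distrib, smul_eq_mul]
    push_cast
    ring
  have e2 : T (IsNilpotent.exp (Q0 + (1 / 4 : ℂ) • ∑ a, Q a ^ 2)) =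
      ∑ p ∈ Fintype.piFinset (fun _ : α => Finset.range (2 * L)),
        ((∏ a, gmom (p a) : ℝ) : ℂ) *
        ((∏ a, ((p a)! : ℂ)⁻¹) * T (IsNilpotent.exp Q0 * ∏ a, Q a ^ p a)) := by
    rw [Finset.smul_sum, hadd _ fun a => ⟨_, hL2 a⟩]
    have : ∀ a, IsNilpotent.exp ((1 / 4 : ℂ) • Q a ^ 2) =
        ∑ k ∈ Finset.range (2 * L), ((gmom k : ℂ) * (k ! : ℂ)⁻¹) • Q a ^ k := by
      intro a
      rw [nexp_eq (hL2 a), sum_range_two_mul']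
      · refine Finset.sum_congr rfl fun k _ => ?_
        rw [smul_pow, smul_smul, ← pow_mul]
        congr 1
        rw [gmom, if_pos (by simp), show 2 * k / 2 = k by omega]
        push_cast
        have h1 : ((2 * k)! : ℂ) ≠ 0 := by exact_mod_cast Nat.factorial_ne_zero _
        have h2 : (k ! : ℂ) ≠ 0 := by exact_mod_cast Nat.factorial_ne_zero _
        field_simp
        rw [← mul_pow]; norm_num
      · intro k hk
        rw [gmom, if_neg hk]
        simp
    simp only [this]
    rw [Finset.prod_univ_sum, Finset.mul_sum, map_sum]
    refine Finset.sum_congr rfl fun p _ => ?_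
    rw [Finset.prod_smul, mul_smul_comm, map_smul, Finset.prod_mul_distrib, smul_eq_mul]
    push_cast
    ring
  rw [e2]
  simp only [e1, Finset.mul_sum]
  have e3 : ∀ (p : α → ℕ) (c : ℂ) ω, (w ω : ℂ) * (((∏ a, g a ω ^ p a : ℝ) : ℂ) * c) =
      ((w ω * ∏ a, g a ω ^ p a : ℝ) : ℂ) * c := by
    intro p c ω; push_cast; ring
  simp only [e3]
  rw [integral_finsetSum]
  · refine Finset.sum_congr rfl fun p _ => ?_
    rw [integral_mul_const, integral_complex_ofReal, hg.eq]
  · intro p _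
    exact (hg.int p).ofReal.mul_const _
end Wick

end Analytic

section Final
variable {K : ℕ}

theorem sum_pairs {A : Type} [AddCommMonoid A] (F : Fin K → Fin K → A) (h : ∀ m, F m m = 0) :
    ∑ m, ∑ m', F m m' = ∑ p : LowerPairs K, (F p.1.1 p.1.2 + F p.1.2 p.1.1) := by
  have h1 : ∀ G : Fin K × Fin K → A, ∑ p : LowerPairs K, G p.1 =
      ∑ p : Fin K × Fin K, if p.2 < p.1 then G p else 0 := by
    intro G
    rw [← Finset.sum_filter]
    exact (Finset.sum_subtype _ (by simp) G).symm
  rw [Finset.sum_add_distrib, h1 (fun p => F p.1 p.2), h1 (fun p => F p.2 p.1),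
    Fintype.sum_prod_type, Fintype.sum_prod_type_right, ← Finset.sum_add_distrib]
  refine Finset.sum_congr rfl fun m _ => ?_
  rw [← Finset.sum_add_distrib]
  refine Finset.sum_congr rfl fun m' _ => ?_
  rcases lt_trichotomy m m' with hlt | rfl | hlt
  · simp [hlt, hlt.not_gt]
  · simp [h]
  · simp [hlt, hlt.not_gt]

theorem card_pairs : Fintype.card (LowerPairs K) = K * (K - 1) / 2 := by
  have h := sum_pairs (K := K) (fun m m' => if m = m' then 0 else 1) (by simp)
  have h2 : ∀ p : LowerPairs K, (if p.1.1 = p.1.2 then 0 else 1) +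
      (if p.1.2 = p.1.1 then 0 else 1) = 2 := by
    intro p
    have := p.2
    simp [this.ne, this.ne']
  have h3 : ∀ m : Fin K, ∑ m', (if m = m' then 0 else 1) = K - 1 := by
    intro m
    rw [Finset.sum_ite]
    simp only [Finset.sum_const_zero, zero_add, Finset.sum_const, smul_eq_mul, mul_one]
    rw [Finset.filter_ne, Finset.card_erase_of_mem (Finset.mem_univ _)]
    simp
  simp only [h2, h3, Finset.sum_const, Finset.card_univ, Fintype.card_fin, smul_eq_mul] at h
  omega

variable {C : Type} [CommRing C] [Algebra ℂ C] {V : Type} [AddCommGroup V] [Module ℂ V]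
  (b : V →ₗ[ℂ] V →ₗ[ℂ] C)

/-- The off-diagonal pairing of two families of generators. -/
def SS {N : ℕ} (χ ψ : Fin N → Fin K → V) (m m' : Fin K) : C := ∑ i, b (χ i m) (ψ i m')

noncomputable def QM {N : ℕ} (χ ψ : Fin N → Fin K → V) (a : Fin N × Fin N) : C :=
  - ∑ m, b (χ a.1 m) (ψ a.2 m)

noncomputable def QB {N : ℕ} (χ ψ : Fin N → Fin K → V) : LowerPairs K ⊕ LowerPairs K → C :=
  Sum.elim (fun p => ((Real.sqrt 2 : ℂ))⁻¹ • (SS b χ χ p.1.1 p.1.2 - SS b ψ ψ p.1.1 p.1.2))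
    (fun p => (((Real.sqrt 2 : ℂ))⁻¹ * Complex.I) •
      (SS b χ χ p.1.1 p.1.2 + SS b ψ ψ p.1.1 p.1.2))

theorem sqrt2_sq : ((Real.sqrt 2 : ℂ))⁻¹ * ((Real.sqrt 2 : ℂ))⁻¹ = 1 / 2 := by
  rw [← mul_inv, ← Complex.ofReal_mul, Real.mul_self_sqrt (by norm_num)]
  norm_num

theorem b_swap (hb0 : ∀ u, b u u = 0) (u v : V) : b u v = - b v u := by
  have h := hb0 (u + v)
  simp only [map_add, LinearMap.add_apply, hb0, zero_add, add_zero] at h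
  exact eq_neg_of_add_eq_zero_right h

theorem squares {N : ℕ} (χ ψ : Fin N → Fin K → V)
    (hb0 : ∀ u, b u u = 0) (hb : ∀ p q r s, b p q * b r s = - (b p r * b q s)) :
    ∑ a, QM b χ ψ a ^ 2 = ∑ a, QB b χ ψ a ^ 2 := by
  have hSsw : ∀ (χ : Fin N → Fin K → V) m m', SS b χ χ m m' = - SS b χ χ m' m := by
    intro χ m m'
    rw [SS, SS, ← Finset.sum_neg_distrib]
    exact Finset.sum_congr rfl fun i _ => b_swap b hb0 _ _
  have h1 : ∑ a, QM b χ ψ a ^ 2 = ∑ m, ∑ m', - (SS b χ χ m m' * SS b ψ ψ m m') := by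
    have : ∀ a, QM b χ ψ a ^ 2 =
        ∑ m, ∑ m', - (b (χ a.1 m) (χ a.1 m') * b (ψ a.2 m) (ψ a.2 m')) := by
      intro a
      rw [QM, neg_sq, pow_two, Finset.sum_mul_sum]
      simp only [← hb]
    simp only [this]
    rw [Finset.sum_comm]
    refine Finset.sum_congr rfl fun m _ => ?_
    rw [Finset.sum_comm]
    refine Finset.sum_congr rfl fun m' _ => ?_
    rw [SS, SS, Finset.sum_mul_sum, Fintype.sum_prod_type, ← Finset.sum_neg_distrib]
    exact Finset.sum_congr rfl fun i _ => by rw [Finset.sum_neg_distrib]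
  rw [h1, sum_pairs _ (by intro m; simp [SS, hb0]), Fintype.sum_sum_type,
    ← Finset.sum_add_distrib]
  refine Finset.sum_congr rfl fun p _ => ?_
  simp only [QB, Sum.elim_inl, Sum.elim_inr, smul_pow, mul_pow, Complex.I_sq]
  rw [pow_two (((Real.sqrt 2 : ℂ))⁻¹), sqrt2_sq, hSsw χ p.1.2 p.1.1, hSsw ψ p.1.2 p.1.1]
  generalize SS b χ χ p.1.1 p.1.2 = X
  generalize SS b ψ ψ p.1.1 p.1.2 = Y
  have e : (1 / 2 : ℂ) • (4 * (X * Y)) = 2 * (X * Y) := by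
    rw [show (4 * (X * Y)) = (4 : ℂ) • (X * Y) by rw [Algebra.smul_def, map_ofNat], smul_smul,
      Algebra.smul_def]
    norm_num [map_ofNat]
  calc _ = - (2 * (X * Y)) := by ring
    _ = - ((1 / 2 : ℂ) • (4 * (X * Y))) := by rw [e]
    _ = - ((1 / 2 : ℂ) • ((X + Y) ^ 2 - (X - Y) ^ 2)) := by congr 2; ring
    _ = _ := by rw [smul_sub, mul_neg_one, neg_smul]; ring

theorem quadM {N : ℕ} (χ ψ : Fin N → Fin K → V) (x : Fin K → ℂ) (M : Matrix (Fin N) (Fin N) ℂ) :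
    ∑ r : Fin N × Fin K, ∑ c : Fin N × Fin K,
      Matrix.blockDiagonal (fun m => x m • (1 : Matrix (Fin N) (Fin N) ℂ) - M) r c •
        b (χ r.1 r.2) (ψ c.1 c.2) =
    ∑ m, x m • SS b χ ψ m m + ∑ a : Fin N × Fin N, M a.1 a.2 • QM b χ ψ a := by
  simp only [Fintype.sum_prod_type, Matrix.blockDiagonal_apply, ite_smul, zero_smul,
    Finset.sum_ite_eq, Finset.mem_univ, if_true, Matrix.sub_apply, Matrix.smul_apply,
    Matrix.one_apply, sub_smul, Finset.sum_sub_distrib, smul_eq_mul, mul_ite, mul_one, mul_zero,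
    QM, smul_neg, Finset.sum_neg_distrib, SS, Finset.smul_sum, ← sub_eq_add_neg]
  congr 1
  · rw [Finset.sum_comm]
  · refine Finset.sum_congr rfl fun i _ => ?_
    rw [Finset.sum_comm]

noncomputable def UU {n : ℕ} (p : Fin (n + n) → V) (s : ℂ) (a : Fin n) : V :=
  ((Real.sqrt 2 : ℂ))⁻¹ • (p (Fin.castAdd n a) + s • p (Fin.natAdd n a))

theorem pairG {n : ℕ} (hb0 : ∀ u, b u u = 0) (p q : Fin (n + n) → V) :
    ∑ a, b (UU p Complex.I a) (UU q (-Complex.I) a) -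
      ∑ a, b (UU q Complex.I a) (UU p (-Complex.I) a) = ∑ i, b (p i) (q i) := by
  rw [Fin.sum_univ_add, ← Finset.sum_sub_distrib, ← Finset.sum_add_distrib]
  refine Finset.sum_congr rfl fun a _ => ?_
  simp only [UU, map_smul, map_add, LinearMap.add_apply, LinearMap.smul_apply, smul_smul,
    sqrt2_sq, smul_add]
  rw [b_swap b hb0 (q _) (p _), b_swap b hb0 (q _) (p _), b_swap b hb0 (q _) (p _),
    b_swap b hb0 (q _) (p _)]
  have hI := Complex.I_mul_I
  have h2 := sqrt2_sq
  match_scalars <;> first | ring1 | linear_combination (-2 * ((Real.sqrt 2 : ℂ))⁻¹ ^ 2) * hI + 2 * h2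


noncomputable def Bmat (x : Fin K → ℂ) (z : LowerPairs K → ℂ) :
    Matrix (Fin K ⊕ Fin K) (Fin K ⊕ Fin K) ℂ :=
  Matrix.fromBlocks (((Real.sqrt 2 : ℂ))⁻¹ • skewZ K z) (Matrix.diagonal x)
    (-(Matrix.diagonal x)) (((Real.sqrt 2 : ℂ))⁻¹ • (skewZ K z)ᴴ)

theorem quadB {n : ℕ} (χ ψ : Fin (n + n) → Fin K → V) (hb0 : ∀ u, b u u = 0) (x : Fin K → ℂ)
    (z : LowerPairs K → ℂ) :
    ∑ r : (Fin K ⊕ Fin K) × Fin n, ∑ c : (Fin K ⊕ Fin K) × Fin n,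
      Matrix.blockDiagonal (fun _ : Fin n => Bmat x z) r c •
        b (UU (fun i => Sum.elim (χ i) (ψ i) r.1) Complex.I r.2)
          (UU (fun i => Sum.elim (χ i) (ψ i) c.1) (-Complex.I) c.2) =
    ∑ m, x m • SS b χ ψ m m + ∑ a : LowerPairs K ⊕ LowerPairs K,
      ((Sum.elim (fun p => (z p).re) (fun p => (z p).im) a : ℝ) : ℂ) • QB b χ ψ a := by
  obtain ⟨G, hG⟩ : ∃ G : (Fin (n + n) → V) → (Fin (n + n) → V) → C, ∀ p q, G p q =
    ∑ a, b (UU p Complex.I a) (UU q (-Complex.I) a) := ⟨_, fun _ _ => rfl⟩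
  have hGG : ∀ p q, G p q - G q p = ∑ i, b (p i) (q i) := fun p q => by
    rw [hG, hG, pairG b hb0]
  have h1 : ∑ r : (Fin K ⊕ Fin K) × Fin n, ∑ c : (Fin K ⊕ Fin K) × Fin n,
      Matrix.blockDiagonal (fun _ : Fin n => Bmat x z) r c •
        b (UU (fun i => Sum.elim (χ i) (ψ i) r.1) Complex.I r.2)
          (UU (fun i => Sum.elim (χ i) (ψ i) c.1) (-Complex.I) c.2) =
      ∑ k, ∑ k', Bmat x z k k' • G (fun i => Sum.elim (χ i) (ψ i) k)
        (fun i => Sum.elim (χ i) (ψ i) k') := by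
    simp only [Fintype.sum_prod_type, Matrix.blockDiagonal_apply, ite_smul, zero_smul,
      Finset.sum_ite_eq, Finset.mem_univ, if_true, hG, Finset.smul_sum]
    exact Finset.sum_congr rfl fun k _ => Finset.sum_comm
  have hZd : ∀ m, skewZ K z m m = 0 := fun m => by simp [skewZ]
  have hZl : ∀ p : LowerPairs K, skewZ K z p.1.1 p.1.2 = z p := fun p => by
    have := p.2
    simp [skewZ, this]
  have hZu : ∀ p : LowerPairs K, skewZ K z p.1.2 p.1.1 = - z p := fun p => by
    have := p.2
    simp [skewZ, this, this.not_gt]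
  rw [h1]
  simp only [Fintype.sum_sum_type, Bmat, Matrix.fromBlocks_apply₁₁, Matrix.fromBlocks_apply₁₂,
    Matrix.fromBlocks_apply₂₁, Matrix.fromBlocks_apply₂₂, Sum.elim_inl, Sum.elim_inr,
    Finset.sum_add_distrib, Matrix.neg_apply, Matrix.diagonal_apply, ite_smul, zero_smul,
    Finset.sum_ite_eq, Finset.mem_univ, if_true, neg_smul, Finset.sum_neg_distrib]
  rw [sum_pairs (fun m m' => (((Real.sqrt 2 : ℂ))⁻¹ • skewZ K z) m m' •
      G (fun i => χ i m) (fun i => χ i m')) (by intro m; simp [hZd]),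
    sum_pairs (fun m m' => (((Real.sqrt 2 : ℂ))⁻¹ • (skewZ K z)ᴴ) m m' •
      G (fun i => ψ i m) (fun i => ψ i m')) (by intro m; simp [hZd])]
  have h2 : ∀ m, x m • SS b χ ψ m m = x m • G (fun i => χ i m) (fun i => ψ i m) -
      x m • G (fun i => ψ i m) (fun i => χ i m) := by
    intro m
    rw [← smul_sub, hGG, SS]
  have h3 : ∀ p : LowerPairs K,
      (((Real.sqrt 2 : ℂ))⁻¹ • skewZ K z) p.1.1 p.1.2 • G (fun i => χ i p.1.1) (fun i => χ i p.1.2) +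
      (((Real.sqrt 2 : ℂ))⁻¹ • skewZ K z) p.1.2 p.1.1 • G (fun i => χ i p.1.2) (fun i => χ i p.1.1) =
      (((Real.sqrt 2 : ℂ))⁻¹ * z p) • SS b χ χ p.1.1 p.1.2 := by
    intro p
    rw [Matrix.smul_apply, Matrix.smul_apply, hZl, hZu, SS, ← hGG]
    simp only [smul_eq_mul]
    module
  have h4 : ∀ p : LowerPairs K,
      (((Real.sqrt 2 : ℂ))⁻¹ • (skewZ K z)ᴴ) p.1.1 p.1.2 •
        G (fun i => ψ i p.1.1) (fun i => ψ i p.1.2) +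
      (((Real.sqrt 2 : ℂ))⁻¹ • (skewZ K z)ᴴ) p.1.2 p.1.1 •
        G (fun i => ψ i p.1.2) (fun i => ψ i p.1.1) =
      (-(((Real.sqrt 2 : ℂ))⁻¹ * star (z p))) • SS b ψ ψ p.1.1 p.1.2 := by
    intro p
    rw [Matrix.smul_apply, Matrix.smul_apply, Matrix.conjTranspose_apply,
      Matrix.conjTranspose_apply, hZl, hZu, SS, ← hGG]
    simp only [smul_eq_mul, star_neg]
    module
  simp only [h2, h3, h4, Finset.sum_sub_distrib, QB, Sum.elim_inl, Sum.elim_inr]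
  have h5 : ∀ p : LowerPairs K, (((Real.sqrt 2 : ℂ))⁻¹ * z p) • SS b χ χ p.1.1 p.1.2 +
      (-(((Real.sqrt 2 : ℂ))⁻¹ * star (z p))) • SS b ψ ψ p.1.1 p.1.2 =
      ((z p).re : ℂ) • ((Real.sqrt 2 : ℂ))⁻¹ • (SS b χ χ p.1.1 p.1.2 - SS b ψ ψ p.1.1 p.1.2) +
      ((z p).im : ℂ) • (((Real.sqrt 2 : ℂ))⁻¹ * Complex.I) •
      (SS b χ χ p.1.1 p.1.2 + SS b ψ ψ p.1.1 p.1.2) := by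
    intro p
    have e1 : z p = (z p).re + (z p).im * Complex.I := (Complex.re_add_im _).symm
    have e2 : star (z p) = (z p).re - (z p).im * Complex.I := by
      apply Complex.ext <;> simp
    rw [e2]
    nth_rewrite 1 [e1]
    module
  have h6 := Finset.sum_congr (rfl : (Finset.univ : Finset (LowerPairs K)) = Finset.univ)
    (fun p _ => h5 p)
  rw [Finset.sum_add_distrib, Finset.sum_add_distrib] at h6
  rw [← h6]
  abel

theorem det_Bmat_zero : (Bmat (fun _ : Fin K => (1 : ℂ)) 0).det = 1 := by
  have hz : skewZ K (0 : LowerPairs K → ℂ) = 0 := by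
    ext i j; simp [skewZ]
  have : Bmat (fun _ : Fin K => (1 : ℂ)) 0 =
      Matrix.fromBlocks 1 1 0 1 * Matrix.fromBlocks 1 0 (-1) 1 * Matrix.fromBlocks 1 1 0 1 := by
    simp [Bmat, hz, Matrix.fromBlocks_multiply]
  rw [this, Matrix.det_mul, Matrix.det_mul, Matrix.det_fromBlocks_zero₂₁,
    Matrix.det_fromBlocks_zero₁₂]
  simp

theorem nilp_b (hb0 : ∀ u, b u u = 0) (hb : ∀ p q r s, b p q * b r s = - (b p r * b q s))
    (u v : V) : b u v ∈ nilradical C := by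
  rw [mem_nilradical]
  exact ⟨2, by rw [pow_two, hb, hb0]; simp⟩

theorem nilp_SS {N : ℕ} (χ ψ : Fin N → Fin K → V) (hb0 : ∀ u, b u u = 0)
    (hb : ∀ p q r s, b p q * b r s = - (b p r * b q s)) (m m' : Fin K) :
    SS b χ ψ m m' ∈ nilradical C :=
  Ideal.sum_mem _ fun _ _ => nilp_b b hb0 hb _ _

theorem nilp_smul (t : ℂ) (y : C) (hy : y ∈ nilradical C) : t • y ∈ nilradical C := by
  rw [Algebra.smul_def]
  exact Ideal.mul_mem_left _ _ hy

end Final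

/-- The Hubbard–Stratonovich integral representation for the expected product of `K`
characteristic polynomials of an `N×N` real Ginibre matrix (`N`, `K` even):
`𝔼_N[∏_m det(M − x_m I)] = ∏_{q<p}[∫ (dz dz̄/π) e^{−|z|²}] det([[Z/√2, X],[−X, Z†/√2]])^{N/2}`,
the `2K×2K` block matrix being skew-symmetric so that its determinant to the power `N/2`
is the `N`-th power of its Pfaffian. -/
theorem hubbard_stratonovich_char_poly (N K : ℕ) (hN : 0 < N) (hNeven : Even N)
    (hK : 2 ≤ K) (hKeven : Even K) (x : Fin K → ℝ) :
    ((∫ M, ∏ m : Fin K,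
        (M - x m • (1 : Matrix (Fin N) (Fin N) ℝ)).det ∂(ginibre N 1) : ℝ) : ℂ) =
      ((Real.pi : ℂ) ^ (K * (K - 1) / 2))⁻¹ *
        ∫ z : LowerPairs K → ℂ,
          Real.exp (-∑ p : LowerPairs K, ‖z p‖ ^ 2) •
            (Matrix.fromBlocks
              (((Real.sqrt 2 : ℂ))⁻¹ • skewZ K z)
              (Matrix.diagonal fun i => (x i : ℂ))
              (-(Matrix.diagonal fun i => (x i : ℂ)))
              (((Real.sqrt 2 : ℂ))⁻¹ • (skewZ K z)ᴴ)).det ^ (N / 2)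
          ∂(Measure.pi fun _ : LowerPairs K => (volume : Measure ℂ)) := by
  obtain ⟨n, rfl⟩ := hNeven
  obtain ⟨C, iC, iA, b, T, hb0, hb, hT, hT1⟩ := exists_berezin (Fin (n + n) × Fin K)
  letI : Algebra ℚ C := Algebra.compHom C (algebraMap ℚ ℂ)
  let V := (Fin (n + n) × Fin K) ⊕ (Fin (n + n) × Fin K) → ℂ
  let χ : Fin (n + n) → Fin K → V := fun i m => Pi.single (Sum.inl (i, m)) 1
  let ψ : Fin (n + n) → Fin K → V := fun i m => Pi.single (Sum.inr (i, m)) 1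
  let u : (Fin K ⊕ Fin K) × Fin n → V :=
    fun r => UU (fun i => Sum.elim (χ i) (ψ i) r.1) Complex.I r.2
  let w : (Fin K ⊕ Fin K) × Fin n → V :=
    fun r => UU (fun i => Sum.elim (χ i) (ψ i) r.1) (-Complex.I) r.2
  obtain ⟨cM, hcM⟩ : ∃ cM : ℂ, cM = T (∏ r : Fin (n + n) × Fin K, b (χ r.1 r.2) (ψ r.1 r.2)) :=
    ⟨_, rfl⟩
  obtain ⟨cB, hcB⟩ : ∃ cB : ℂ, cB = T (∏ r, b (u r) (w r)) := ⟨_, rfl⟩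
  have hcM0 : cM ≠ 0 := by rw [hcM]; exact hT1
  have evM : ∀ (x : Fin K → ℂ) (M : Matrix (Fin (n + n)) (Fin (n + n)) ℂ),
      T (IsNilpotent.exp (∑ m, x m • SS b χ ψ m m +
        ∑ a : Fin (n + n) × Fin (n + n), M a.1 a.2 • QM b χ ψ a)) =
      (∏ m, (x m • (1 : Matrix (Fin (n + n)) (Fin (n + n)) ℂ) - M).det) * cM := by
    intro x M
    rw [← quadM, berezin_det b T _ hb0 hb hT rfl (fun r => χ r.1 r.2) (fun r => ψ r.1 r.2),
      Matrix.det_blockDiagonal, hcM]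
  have evB : ∀ (x : Fin K → ℂ) (z : LowerPairs K → ℂ),
      T (IsNilpotent.exp (∑ m, x m • SS b χ ψ m m + ∑ a : LowerPairs K ⊕ LowerPairs K,
        ((Sum.elim (fun p => (z p).re) (fun p => (z p).im) a : ℝ) : ℂ) • QB b χ ψ a)) =
      (Bmat x z).det ^ n * cB := by
    intro x z
    rw [← quadB b χ ψ hb0, berezin_det b T _ hb0 hb hT ?_ u w, Matrix.det_blockDiagonal, hcB]
    · simp
    · simp; ring
  have hc : cM = cB := by
    have h1 := evM (fun _ => 1) 0
    have h2 := evB (fun _ => 1) 0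
    rw [det_Bmat_zero] at h2
    have h3 : ∀ a : LowerPairs K ⊕ LowerPairs K, Sum.elim (fun p => ((0 : LowerPairs K → ℂ) p).re)
        (fun p => ((0 : LowerPairs K → ℂ) p).im) a = 0 := by
      rintro (a | a) <;> simp
    simp only [h3] at h2
    simp at h1 h2
    rw [← h1, ← h2]
  have hX : IsNilpotent (∑ m, (x m : ℂ) • SS b χ ψ m m) := by
    rw [← mem_nilradical]
    exact Ideal.sum_mem _ fun m _ => nilp_smul _ _ (nilp_SS b χ ψ hb0 hb _ _)
  have hQM : ∀ a, IsNilpotent (QM b χ ψ a) := by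
    intro a
    rw [← mem_nilradical]
    exact neg_mem (Ideal.sum_mem _ fun m _ => nilp_b b hb0 hb _ _)
  have hQB : ∀ a, IsNilpotent (QB b χ ψ a) := by
    intro a
    rw [← mem_nilradical]
    rcases a with a | a
    · exact nilp_smul _ _ (sub_mem (nilp_SS b _ _ hb0 hb _ _) (nilp_SS b _ _ hb0 hb _ _))
    · exact nilp_smul _ _ (add_mem (nilp_SS b _ _ hb0 hb _ _) (nilp_SS b _ _ hb0 hb _ _))
  have hM := wick _ _ _ (gaussFam_pi (n + n)) T _ _ hX hQM
  have hB := wick _ _ _ (gaussFam_complex (LowerPairs K)) T _ _ hX hQB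
  rw [squares b χ ψ hb0 hb, ← hB] at hM
  have hdet : ∀ M : Matrix (Fin (n + n)) (Fin (n + n)) ℝ,
      ∏ m, (((x m : ℂ)) • (1 : Matrix (Fin (n + n)) (Fin (n + n)) ℂ) - M.map (fun t => (t : ℂ))).det
      = ((∏ m, (M - x m • (1 : Matrix (Fin (n + n)) (Fin (n + n)) ℝ)).det : ℝ) : ℂ) := by
    intro M
    rw [Complex.ofReal_prod]
    refine Finset.prod_congr rfl fun m _ => ?_
    have e : (((M - x m • (1 : Matrix (Fin (n + n)) (Fin (n + n)) ℝ)).det : ℝ) : ℂ) =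
      Complex.ofRealHom (M - x m • (1 : Matrix (Fin (n + n)) (Fin (n + n)) ℝ)).det := rfl
    rw [e, RingHom.map_det, ← neg_sub, Matrix.det_neg]
    simp only [Fintype.card_fin, Even.neg_one_pow ⟨n, rfl⟩, one_mul]
    congr 1
    ext i j
    simp [Matrix.one_apply]
    split_ifs <;> simp
  have hM2 : ∀ M : Fin (n + n) → Fin (n + n) → ℝ,
      ((1 : ℝ) : ℂ) * T (IsNilpotent.exp (∑ m, (x m : ℂ) • SS b χ ψ m m +
        ∑ a : Fin (n + n) × Fin (n + n), (M a.1 a.2 : ℂ) • QM b χ ψ a)) =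
      ((∏ m, (Matrix.of M -
        x m • (1 : Matrix (Fin (n + n)) (Fin (n + n)) ℝ)).det : ℝ) : ℂ) * cM := by
    intro M
    rw [← hdet, ← evM, Complex.ofReal_one, one_mul]
    rfl
  have hB2 : ∀ z : LowerPairs K → ℂ,
      ((∏ p : LowerPairs K, (Real.pi⁻¹ * Real.exp (-‖z p‖ ^ 2)) : ℝ) : ℂ) *
      ((Bmat (fun m => (x m : ℂ)) z).det ^ n * cB) =
      (((Real.pi : ℂ) ^ (K * (K - 1) / 2))⁻¹ * (Real.exp (-∑ p : LowerPairs K, ‖z p‖ ^ 2) •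
        (Bmat (fun m => (x m : ℂ)) z).det ^ n)) * cB := by
    intro z
    rw [Finset.prod_mul_distrib, Finset.prod_const, Finset.card_univ, card_pairs,
      ← Real.exp_sum, Finset.sum_neg_distrib, Complex.real_smul]
    push_cast
    ring
  simp only [hM2, evB, hB2] at hM
  rw [integral_mul_const, integral_mul_const, integral_const_mul, integral_complex_ofReal,
    ← hc] at hM
  have hfin := mul_right_cancel₀ hcM0 hM
  have hn : (n + n) / 2 = n := by omega
  rw [hn]
  exact hfin
end
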